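/- Let r > 1 be a real number that is not an integer, and set q = ⌊r⌋ + 1, Q = 2^q, κ = 1/(4Q − 2), λ = 1 − (q + 1)/(4Q − 2). There exists a constant C = C(r) such that for every real K ≥ 3, every integer e ≥ 1 and every real θ, one has |Σ_{K ≤ k < 2K} ψ(k^r/e + θ)| ≤ C·( e · K^{1 − r} + e^{−κ/(1+κ)} · K^{(rκ + λ)/(1 + κ)} ), where the sum is over positive integers k with K ≤ k < 2K and ψ(t) = t − ⌊t⌋ − 1/2. -/

import Mathlib

/-- The sawtooth function `ψ(t) = t − ⌊t⌋ − 1/2`. -/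
noncomputable def saw (t : ℝ) : ℝ := t - ⌊t⌋ - 1 / 2

/-- The additive character `e(x) = exp(2πix)`. -/
noncomputable def unitExp (x : ℝ) : ℂ := Complex.exp ((2 * Real.pi * x : ℝ) * Complex.I)

lemma norm_unitExp (x : ℝ) : ‖unitExp x‖ = 1 := Complex.norm_exp_ofReal_mul_I _

lemma unitExp_add (x y : ℝ) : unitExp (x + y) = unitExp x * unitExp y := by
  rw [unitExp, unitExp, unitExp, ← Complex.exp_add]; congr 1; push_cast; ring

lemma unitExp_int (m : ℤ) : unitExp m = 1 := by
  rw [unitExp, Complex.exp_eq_one_iff]; exact ⟨m, by push_cast; ring⟩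

lemma unitExp_neg (x : ℝ) : unitExp (-x) = starRingEnd ℂ (unitExp x) := by
  rw [unitExp, unitExp, ← Complex.exp_conj, map_mul, Complex.conj_I, Complex.conj_ofReal]
  congr 1; push_cast; ring

lemma norm_sum_unitExp_le (f : ℕ → ℝ) (N : ℕ) : ‖∑ n ∈ Finset.range N, unitExp (f n)‖ ≤ N := by
  refine (norm_sum_le _ _).trans ?_
  simp [norm_unitExp]

lemma norm_sum_unitExp_neg (f : ℕ → ℝ) (N : ℕ) :
    ‖∑ n ∈ Finset.range N, unitExp (-f n)‖ = ‖∑ n ∈ Finset.range N, unitExp (f n)‖ := by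
  simp_rw [unitExp_neg]
  rw [← map_sum, RCLike.norm_conj]

lemma one_sub_unitExp_mul (x : ℝ) (hx : Real.sin (Real.pi * x) ≠ 0) :
    (1 - unitExp x) * (1 / 2 + ((Real.cot (Real.pi * x) / 2 : ℝ) : ℂ) * Complex.I) = 1 := by
  have h : unitExp x = (Real.cos (Real.pi * x) + Real.sin (Real.pi * x) * Complex.I) ^ 2 := by
    rw [unitExp, Complex.ofReal_cos, Complex.ofReal_sin, ← Complex.exp_mul_I, ← Complex.exp_nat_mul]
    congr 1; push_cast; ring
  rw [h, Real.cot_eq_cos_div_sin]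
  have h2 : ((Real.sin (Real.pi * x) : ℝ) : ℂ) ^ 2 + ((Real.cos (Real.pi * x) : ℝ) : ℂ) ^ 2 = 1 := by
    exact_mod_cast Real.sin_sq_add_cos_sq _
  have h3 : ((Real.sin (Real.pi * x) : ℝ) : ℂ) ≠ 0 := by exact_mod_cast hx
  generalize Real.sin (Real.pi * x) = s at *
  generalize Real.cos (Real.pi * x) = c at *
  push_cast
  field_simp
  have hI := Complex.I_sq
  have hI3 : Complex.I ^ 3 = -Complex.I := by rw [pow_succ, hI]; ring
  ring_nf
  rw [hI3, hI]
  linear_combination (-(c : ℂ) * Complex.I + s) * h2 + (s - (s : ℂ) + 0) * hI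

lemma two_mul_le_sin_pi_mul {t x : ℝ} (ht : 0 < t) (h1 : t ≤ x) (h2 : x ≤ 1 - t) :
    2 * t ≤ Real.sin (Real.pi * x) := by
  have hpi := Real.pi_pos
  rcases le_total x (1 / 2) with h | h
  · have := Real.mul_le_sin (x := Real.pi * x) (by nlinarith) (by nlinarith)
    have e : 2 / Real.pi * (Real.pi * x) = 2 * x := by field_simp
    linarith
  · have := Real.mul_le_sin (x := Real.pi * (1 - x)) (by nlinarith) (by nlinarith)
    have e : 2 / Real.pi * (Real.pi * (1 - x)) = 2 * (1 - x) := by field_simp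
    have e2 : Real.sin (Real.pi * (1 - x)) = Real.sin (Real.pi * x) := by
      rw [← Real.sin_pi_sub]; congr 1; ring
    linarith

lemma abs_cot_pi_mul_le {t x : ℝ} (ht : 0 < t) (h1 : t ≤ x) (h2 : x ≤ 1 - t) :
    |Real.cot (Real.pi * x)| ≤ 1 / (2 * t) := by
  have h := two_mul_le_sin_pi_mul ht h1 h2
  rw [Real.cot_eq_cos_div_sin, abs_div, abs_of_pos (by linarith : 0 < Real.sin (Real.pi * x))]
  exact div_le_div₀ zero_le_one (Real.abs_cos_le_one _) (by linarith) h

lemma cot_pi_mul_antitone {t x y : ℝ} (ht : 0 < t) (h1 : t ≤ x) (hxy : x ≤ y) (h2 : y ≤ 1 - t) :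
    Real.cot (Real.pi * y) ≤ Real.cot (Real.pi * x) := by
  have hx := two_mul_le_sin_pi_mul ht h1 (by linarith)
  have hy := two_mul_le_sin_pi_mul ht (h1.trans hxy) h2
  have hpi := Real.pi_pos
  rw [Real.cot_eq_cos_div_sin, Real.cot_eq_cos_div_sin, div_le_div_iff₀ (by linarith) (by linarith)]
  have : 0 ≤ Real.sin (Real.pi * y - Real.pi * x) :=
    Real.sin_nonneg_of_nonneg_of_le_pi (by nlinarith) (by nlinarith)
  rw [Real.sin_sub] at this
  linarith

lemma norm_one_half_add_cot_le {t x : ℝ} (ht : 0 < t) (h1 : t ≤ x) (h2 : x ≤ 1 - t) :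
    ‖(1 / 2 + ((Real.cot (Real.pi * x) / 2 : ℝ) : ℂ) * Complex.I)‖ ≤ 1 / (2 * t) := by
  have h := abs_cot_pi_mul_le ht h1 h2
  refine (norm_add_le _ _).trans ?_
  rw [norm_mul, Complex.norm_I, Complex.norm_real, Real.norm_eq_abs, abs_div]
  have : 1 ≤ 1 / (2 * t) := by rw [le_div_iff₀ (by linarith)]; linarith
  norm_num at *
  linarith

lemma sum_sub_mul_by_parts (E c : ℕ → ℂ) (M : ℕ) :
    ∑ n ∈ Finset.range (M + 1), (E n - E (n + 1)) * c n =
      E 0 * c 0 - E (M + 1) * c M + ∑ n ∈ Finset.range M, E (n + 1) * (c (n + 1) - c n) := by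
  induction M with
  | zero => simp; ring
  | succ M ih => rw [Finset.sum_range_succ, ih, Finset.sum_range_succ _ M]; ring

/-- The Kuzmin–Landau inequality. -/
lemma norm_sum_unitExp_le_of_monotone (f : ℕ → ℝ) (N : ℕ) {t : ℝ} (ht : 0 < t)
    (hmono : ∀ n, n + 1 < N → f (n + 1) - f n ≤ f (n + 2) - f (n + 1))
    (hlo : ∀ n < N, t ≤ f (n + 1) - f n) (hhi : ∀ n < N, f (n + 1) - f n ≤ 1 - t) :
    ‖∑ n ∈ Finset.range N, unitExp (f n)‖ ≤ 2 / t := by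
  rcases N with _ | M
  · simp; positivity
  set d : ℕ → ℝ := fun n => f (n + 1) - f n with hd
  set g : ℕ → ℝ := fun n => Real.cot (Real.pi * d n) with hg
  set c : ℕ → ℂ := fun n => 1 / 2 + ((g n / 2 : ℝ) : ℂ) * Complex.I with hc
  have key : ∀ n ∈ Finset.range (M + 1), unitExp (f n) =
      (unitExp (f n) - unitExp (f (n + 1))) * c n := by
    intro n hn
    have hn := Finset.mem_range.1 hn
    have h1 := one_sub_unitExp_mul (d n)
      (by have := two_mul_le_sin_pi_mul ht (hlo n hn) (hhi n hn); simp only [hd]; linarith)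
    have h2 : unitExp (f (n + 1)) = unitExp (f n) * unitExp (d n) := by
      rw [← unitExp_add]; congr 1; simp [hd]
    rw [h2]
    linear_combination (-unitExp (f n)) * h1
  rw [Finset.sum_congr rfl key, sum_sub_mul_by_parts (fun n => unitExp (f n)) c M]
  have hc0 : ∀ n < M + 1, ‖c n‖ ≤ 1 / (2 * t) := fun n hn =>
    norm_one_half_add_cot_le ht (hlo n hn) (hhi n hn)
  have hg0 : ∀ n < M + 1, |g n| ≤ 1 / (2 * t) := fun n hn =>
    abs_cot_pi_mul_le ht (hlo n hn) (hhi n hn)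
  have hs : ‖∑ n ∈ Finset.range M, unitExp (f (n + 1)) * (c (n + 1) - c n)‖ ≤ 1 / (2 * t) := by
    calc _ ≤ ∑ n ∈ Finset.range M, (g n / 2 - g (n + 1) / 2) := by
          refine norm_sum_le_of_le _ fun n hn => ?_
          have hn := Finset.mem_range.1 hn
          have e : c (n + 1) - c n = ((g (n + 1) / 2 - g n / 2 : ℝ) : ℂ) * Complex.I := by
            simp only [hc]; push_cast; ring
          have := cot_pi_mul_antitone ht (hlo n (by omega)) (hmono n (by omega)) (hhi (n + 1) (by omega))
          rw [norm_mul, norm_unitExp, e, norm_mul, Complex.norm_I, Complex.norm_real,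
            Real.norm_eq_abs, abs_of_nonpos]
          · linarith
          · simp only [hg, hd]; linarith
      _ = g 0 / 2 - g M / 2 := Finset.sum_range_sub' (fun n => g n / 2) M
      _ ≤ _ := by
          have h1 := abs_le.1 (hg0 0 (by omega))
          have h2 := abs_le.1 (hg0 M (by omega))
          linarith
  have e : 2 / t = 4 * (1 / (2 * t)) := by field_simp; norm_num
  have hp : 0 < 1 / (2 * t) := by positivity
  calc _ ≤ ‖unitExp (f 0) * c 0‖ + ‖unitExp (f (M + 1)) * c M‖ + _ :=
        (norm_add_le _ _).trans (add_le_add_left (norm_sub_le _ _) _)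
    _ ≤ 1 / (2 * t) + 1 / (2 * t) + 1 / (2 * t) := by
        rw [norm_mul, norm_mul, norm_unitExp, norm_unitExp, one_mul, one_mul]
        exact add_le_add (add_le_add (hc0 0 (by omega)) (hc0 M (by omega))) hs
    _ ≤ _ := by linarith

lemma exists_threshold_of_monotone (d : ℕ → ℝ) (M : ℕ) (hd : ∀ n, n + 1 < M → d n ≤ d (n + 1))
    (t : ℝ) : ∃ p ≤ M, (∀ n < p, d n < t) ∧ ∀ n, p ≤ n → n < M → t ≤ d n := by
  induction M with
  | zero => exact ⟨0, le_rfl, by simp, by simp⟩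
  | succ M ih =>
    obtain ⟨p, hp, h1, h2⟩ := ih fun n hn => hd n (by omega)
    rcases le_or_gt t (d M) with h | h
    · refine ⟨p, by omega, h1, fun n hn hn' => ?_⟩
      rcases Nat.lt_succ_iff_lt_or_eq.1 hn' with h' | rfl
      · exact h2 n hn h'
      · exact h
    · refine ⟨M + 1, le_rfl, fun n hn => ?_, fun n hn hn' => by omega⟩
      by_contra hcon
      have hnM : n ≤ M := by omega
      have : ∀ j, n ≤ j → j ≤ M → t ≤ d j := by
        intro j hj
        induction j, hj using Nat.le_induction with
        | base => intro _; linarith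
        | succ j hj ihj => intro hjM; exact (ihj (by omega)).trans (hd j (by omega))
      linarith [this M hnM le_rfl]

lemma norm_sum_unitExp_sub_int_mul (f : ℕ → ℝ) (N : ℕ) (m : ℤ) :
    ‖∑ n ∈ Finset.range N, unitExp (f n - m * n)‖ = ‖∑ n ∈ Finset.range N, unitExp (f n)‖ := by
  congr 1
  refine Finset.sum_congr rfl fun n _ => ?_
  have : f n - m * n = f n + ((-m * n : ℤ) : ℝ) := by push_cast; ring
  rw [this, unitExp_add, unitExp_int, mul_one]

lemma norm_sum_unitExp_le_of_short_aux (f : ℕ → ℝ) (M : ℕ) {lam : ℝ} (h0 : 0 < lam)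
    (hl : lam ≤ 1 / 16)
    (hd : ∀ n, n + 1 < M → lam ≤ (f (n + 2) - f (n + 1)) - (f (n + 1) - f n))
    (hlo : ∀ n < M, -(3 / 4) ≤ f (n + 1) - f n) (hhi : ∀ n < M, f (n + 1) - f n ≤ 3 / 4) :
    ‖∑ n ∈ Finset.range M, unitExp (f n)‖ ≤ 7 / √lam := by
  set t := √lam with ht
  have htp : 0 < t := Real.sqrt_pos.2 h0
  have ht2 : t * t = lam := Real.mul_self_sqrt h0.le
  have ht4 : t ≤ 1 / 4 := by nlinarith
  obtain ⟨p, hpM, hp1, hp2⟩ := exists_threshold_of_monotone (fun n => f (n + 1) - f n) M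
    (fun n hn => by have := hd n hn; simp only [add_assoc]; norm_num; linarith) (-t)
  obtain ⟨s, hsM, hs1, hs2⟩ := exists_threshold_of_monotone
    (fun n => f (p + n + 1) - f (p + n)) (M - p)
    (fun n hn => by
      have := hd (p + n) (by omega); simp only [← add_assoc]; norm_num at *; linarith) t
  obtain ⟨u, rfl⟩ : ∃ u, M = p + s + u := ⟨M - p - s, by omega⟩
  rw [Finset.sum_range_add, Finset.sum_range_add]
  have b1 : ‖∑ n ∈ Finset.range p, unitExp (f n)‖ ≤ 2 / t := by
    rw [← norm_sum_unitExp_sub_int_mul f p (-1)]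
    refine norm_sum_unitExp_le_of_monotone _ _ htp (fun n hn => ?_) (fun n hn => ?_) (fun n hn => ?_)
    · have := hd n (by omega); push_cast; linarith
    · have := hlo n (by omega); push_cast; linarith
    · have := hp1 n (by omega); push_cast; linarith
  have b3 : ‖∑ n ∈ Finset.range u, unitExp (f (p + s + n))‖ ≤ 2 / t := by
    refine norm_sum_unitExp_le_of_monotone (fun n => f (p + s + n)) _ htp (fun n hn => ?_)
      (fun n hn => ?_) (fun n hn => ?_)
    · have := hd (p + s + n) (by omega); simp only [← add_assoc]; linarith
    · have := hs2 (s + n) (by omega) (by omega)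
      simpa only [← add_assoc] using this
    · have := hhi (p + s + n) (by omega); simp only [← add_assoc]; linarith
  have b2 : ‖∑ n ∈ Finset.range s, unitExp (f (p + n))‖ ≤ 3 / t := by
    refine (norm_sum_unitExp_le (fun n => f (p + n)) s).trans ?_
    rcases s with _ | s
    · simp; positivity
    have hgrow : ∀ j ≤ s, j * lam ≤ (f (p + j + 1) - f (p + j)) - (f (p + 1) - f p) := by
      intro j
      induction j with
      | zero => intro _; simp
      | succ j ih =>
        intro hj
        have h1 := ih (by omega)
        have h2 := hd (p + j) (by omega)
        push_cast
        simp only [← add_assoc]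
        norm_num [add_assoc] at *
        linarith
    have h1 := hgrow s le_rfl
    have h2 := hs1 s (by omega)
    have h3 := hp2 p le_rfl (by omega)
    rw [le_div_iff₀ htp]
    push_cast
    have h4 : (s : ℝ) * lam ≤ 2 * t := by linarith
    have h5 : (s : ℝ) * t ≤ 2 := by
      rw [← ht2] at h4
      by_contra hc; push Not at hc; nlinarith
    nlinarith
  calc _ ≤ _ + _ + _ := (norm_add_le _ _).trans (add_le_add_left (norm_add_le _ _) _)
    _ ≤ 2 / t + 3 / t + 2 / t := add_le_add (add_le_add b1 b2) b3
    _ = 7 / t := by ring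

lemma norm_sum_unitExp_le_of_short (f : ℕ → ℝ) (M : ℕ) {lam x : ℝ} (h0 : 0 < lam)
    (hl : lam ≤ 1 / 16)
    (hd : ∀ n, n + 1 < M → lam ≤ (f (n + 2) - f (n + 1)) - (f (n + 1) - f n))
    (hlo : ∀ n < M, x ≤ f (n + 1) - f n) (hhi : ∀ n < M, f (n + 1) - f n ≤ x + 1 / 2) :
    ‖∑ n ∈ Finset.range M, unitExp (f n)‖ ≤ 7 / √lam := by
  rw [← norm_sum_unitExp_sub_int_mul f M (round (x + 1 / 4))]
  have hr := abs_le.1 (abs_sub_round (x + 1 / 4))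
  refine norm_sum_unitExp_le_of_short_aux _ M h0 hl (fun n hn => ?_) (fun n hn => ?_)
    (fun n hn => ?_)
  · have := hd n hn; push_cast; linarith
  · have := hlo n hn; push_cast; linarith
  · have := hhi n hn; push_cast; linarith

lemma norm_sum_range_le_of_blocks {F : ℕ → ℂ} {M : ℕ} (hM : 0 < M) {B : ℝ} (hB : 0 ≤ B) (N : ℕ)
    (h : ∀ a m, m ≤ M → a + m ≤ N → ‖∑ n ∈ Finset.range m, F (a + n)‖ ≤ B) :
    ‖∑ n ∈ Finset.range N, F n‖ ≤ (N / M + 1) * B := by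
  induction N using Nat.strong_induction_on generalizing F with
  | _ N ih =>
    have hM' : (0 : ℝ) < M := by exact_mod_cast hM
    rcases le_total N M with hN | hN
    · have := h 0 N hN (by simp)
      simp only [zero_add] at this
      refine this.trans ?_
      have : (0 : ℝ) ≤ N / M * B := by positivity
      linarith
    · obtain ⟨u, rfl⟩ : ∃ u, N = M + u := ⟨N - M, by omega⟩
      rw [Finset.sum_range_add]
      have h1 := h 0 M le_rfl (by omega)
      simp only [zero_add] at h1
      have h2 := ih u (by omega) (F := fun n => F (M + n)) (fun a m hm ham => by
        simpa only [add_assoc] using h (M + a) m hm (by omega))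
      have e : (((M + u : ℕ) : ℝ) / M + 1) * B = B + (u / M + 1) * B := by
        push_cast; field_simp; ring
      rw [e]
      exact (norm_add_le _ _).trans (add_le_add h1 h2)

/-- The second derivative test, for second differences. -/
lemma norm_sum_unitExp_le_of_second_diff {A : ℝ} (hA : 1 ≤ A) (N : ℕ) (f : ℕ → ℝ) {lam : ℝ}
    (h0 : 0 < lam)
    (h1 : ∀ n < N, lam ≤ (f (n + 2) - f (n + 1)) - (f (n + 1) - f n))
    (h2 : ∀ n < N, (f (n + 2) - f (n + 1)) - (f (n + 1) - f n) ≤ A * lam) :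
    ‖∑ n ∈ Finset.range N, unitExp (f n)‖ ≤ 28 * A * (N * √lam + 1 / √lam) := by
  have hs : 0 < √lam := Real.sqrt_pos.2 h0
  have hs2 : √lam * √lam = lam := Real.mul_self_sqrt h0.le
  rcases le_or_gt lam (1 / (16 * A)) with hl | hl
  · have hAl : A * lam ≤ 1 / 16 := by
      rw [le_div_iff₀ (by positivity)] at hl; linarith
    set M := ⌊1 / (2 * (A * lam))⌋₊ with hM
    have hy : 8 ≤ 1 / (2 * (A * lam)) := by
      rw [le_div_iff₀ (by positivity)]; linarith
    have hM1 : (M : ℝ) ≤ 1 / (2 * (A * lam)) := Nat.floor_le (by positivity)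
    have hM2 : 1 / (2 * (A * lam)) < M + 1 := Nat.lt_floor_add_one _
    have hMp : (0 : ℝ) < M := by linarith
    have hM1' : M * (A * lam) ≤ 1 / 2 := by
      rw [le_div_iff₀ (by positivity)] at hM1; linarith
    have hM2' : 1 ≤ 4 * A * lam * M := by
      have : 1 / (2 * (A * lam)) ≤ 2 * M := by linarith
      rw [div_le_iff₀ (by positivity)] at this; linarith
    have hB := norm_sum_range_le_of_blocks (F := fun n => unitExp (f n)) (M := M)
      (by exact_mod_cast hMp) (B := 7 / √lam) (by positivity) N (fun a m hm ham => by
        have hrange : ∀ j, j < m → f (a + 1) - f a ≤ f (a + j + 1) - f (a + j) ∧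
            f (a + j + 1) - f (a + j) ≤ f (a + 1) - f a + j * (A * lam) := by
          intro j
          induction j with
          | zero => intro _; simp
          | succ j ih =>
            intro hj
            have i1 := ih (by omega)
            have i2 := h1 (a + j) (by omega)
            have i3 := h2 (a + j) (by omega)
            push_cast
            simp only [← add_assoc]
            norm_num [add_assoc] at *
            constructor <;> linarith
        refine norm_sum_unitExp_le_of_short (fun n => f (a + n)) m (x := f (a + 1) - f a) h0
          (by nlinarith) (fun n hn => ?_) (fun n hn => ?_) (fun n hn => ?_)
        · simpa only [← add_assoc] using h1 (a + n) (by omega)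
        · simpa only [← add_assoc] using (hrange n hn).1
        · have i1 := (hrange n hn).2
          have i2 : (n : ℝ) * (A * lam) ≤ M * (A * lam) := by
            have : (n : ℝ) ≤ M := by exact_mod_cast (by omega : n ≤ M)
            gcongr
          simp only [← add_assoc]
          linarith)
    refine hB.trans ?_
    have e1 : (N : ℝ) / M ≤ 4 * A * lam * N := by
      rw [div_le_iff₀ hMp]
      have : (0 : ℝ) ≤ N := by positivity
      nlinarith
    calc ((N : ℝ) / M + 1) * (7 / √lam) ≤ (4 * A * lam * N + 1) * (7 / √lam) := by gcongr
      _ = 28 * A * (N * √lam) + 7 * (1 / √lam) := by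
          have e2 : lam / √lam = √lam := Real.div_sqrt
          have e3 : (4 * A * lam * N + 1) * (7 / √lam) =
            28 * A * (N * (lam / √lam)) + 7 * (1 / √lam) := by ring
          rw [e3, e2]
      _ ≤ _ := by
          have : 0 < 1 / √lam := by positivity
          nlinarith
  · refine (norm_sum_unitExp_le f N).trans ?_
    have h3 : 1 ≤ 4 * A * √lam := by
      rw [div_lt_iff₀ (by positivity)] at hl
      have h4 : 1 < (4 * A * √lam) ^ 2 := by
        have : (4 * A * √lam) ^ 2 = 16 * A * A * lam := by
          rw [mul_pow, sq √lam, hs2]; ring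
        rw [this]; nlinarith
      nlinarith [mul_pos (by linarith : 0 < 4 * A) hs]
    have : (0 : ℝ) ≤ N := by positivity
    have h5 : 0 < 1 / √lam := by positivity
    nlinarith [mul_nonneg this (by linarith : 0 ≤ 4 * A * √lam - 1),
      mul_pos (by linarith : 0 < A) h5, mul_nonneg this (mul_nonneg (by linarith : 0 ≤ A) hs.le)]

lemma sum_range_eq_sum_shift {G : ℕ → ℂ} {a b c : ℕ} (h1 : ∀ t < a, G t = 0)
    (h2 : ∀ t, a + b ≤ t → G t = 0) :
    ∑ t ∈ Finset.range (a + b + c), G t = ∑ n ∈ Finset.range b, G (a + n) := by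
  rw [Finset.sum_range_add, Finset.sum_range_add,
    Finset.sum_eq_zero (s := Finset.range a) (fun t ht => h1 t (Finset.mem_range.1 ht)),
    Finset.sum_eq_zero (s := Finset.range c) (fun t _ => h2 _ (by omega)), zero_add, add_zero]

lemma sum_range_dist_le {ρ : ℕ → ℝ} (hρ : ∀ m, 0 ≤ ρ m) {H h : ℕ} (hh : h < H) :
    ∑ j ∈ Finset.range H, ρ (Nat.dist h j) ≤ ρ 0 + 2 * ∑ j ∈ Finset.range (H - 1), ρ (j + 1) := by
  obtain ⟨u, rfl⟩ : ∃ u, H = h + 1 + u := ⟨H - h - 1, by omega⟩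
  rw [Finset.sum_range_add, Finset.sum_range_succ, Nat.dist_self]
  have e1 : ∑ j ∈ Finset.range h, ρ (Nat.dist h j) = ∑ j ∈ Finset.range h, ρ (j + 1) := by
    rw [← Finset.sum_range_reflect]
    refine Finset.sum_congr rfl fun j hj => ?_
    have := Finset.mem_range.1 hj
    congr 1
    rw [Nat.dist_comm, Nat.dist_eq_sub_of_le (by omega)]; omega
  have e2 : ∑ j ∈ Finset.range u, ρ (Nat.dist h (h + 1 + j)) = ∑ j ∈ Finset.range u, ρ (j + 1) := by
    refine Finset.sum_congr rfl fun j hj => ?_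
    congr 1
    rw [Nat.dist_eq_sub_of_le (by omega)]; omega
  have i1 : ∑ j ∈ Finset.range h, ρ (j + 1) ≤ ∑ j ∈ Finset.range (h + 1 + u - 1), ρ (j + 1) :=
    Finset.sum_le_sum_of_subset_of_nonneg (Finset.range_mono (by omega)) fun _ _ _ => hρ _
  have i2 : ∑ j ∈ Finset.range u, ρ (j + 1) ≤ ∑ j ∈ Finset.range (h + 1 + u - 1), ρ (j + 1) :=
    Finset.sum_le_sum_of_subset_of_nonneg (Finset.range_mono (by omega)) fun _ _ _ => hρ _
  rw [e1, e2]
  linarith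

/-- The Weyl–van der Corput inequality. -/
lemma norm_sum_sq_le_correlations (z : ℕ → ℂ) {N H : ℕ} (hH : 0 < H) (hHN : H ≤ N) :
    ‖∑ n ∈ Finset.range N, z n‖ ^ 2 ≤ 2 * N / H *
      (‖∑ n ∈ Finset.range N, z n * starRingEnd ℂ (z n)‖ + 2 * ∑ j ∈ Finset.range (H - 1),
        ‖∑ n ∈ Finset.range (N - (j + 1)), z (n + (j + 1)) * starRingEnd ℂ (z n)‖) := by
  set ρ : ℕ → ℝ := fun m =>
    ‖∑ n ∈ Finset.range (N - m), z (n + m) * starRingEnd ℂ (z n)‖ with hρ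
  set Y : ℕ → ℕ → ℂ := fun t h => if h ≤ t ∧ t < h + N then z (t - h) else 0 with hY
  have hYS : ∀ h < H, ∑ t ∈ Finset.range (N + H), Y t h = ∑ n ∈ Finset.range N, z n := by
    intro h hh
    have e : N + H = h + N + (H - h) := by omega
    rw [e, sum_range_eq_sum_shift]
    · refine Finset.sum_congr rfl fun n hn => ?_
      have := Finset.mem_range.1 hn
      simp only [hY]; rw [if_pos (by omega)]; congr 1; omega
    · intro t ht; simp only [hY]; rw [if_neg (by omega)]
    · intro t ht; simp only [hY]; rw [if_neg (by omega)]
  have hP : ∀ h h', h ≤ h' → h' < H →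
      ‖∑ t ∈ Finset.range (N + H), Y t h * starRingEnd ℂ (Y t h')‖ = ρ (Nat.dist h h') := by
    intro h h' hhh hh'
    rw [Nat.dist_eq_sub_of_le hhh]
    have e : N + H = h' + (N - (h' - h)) + (H - h) := by omega
    rw [e, sum_range_eq_sum_shift]
    · simp only [hρ]
      congr 1
      refine Finset.sum_congr rfl fun n hn => ?_
      have := Finset.mem_range.1 hn
      simp only [hY]; rw [if_pos (by omega), if_pos (by omega)]
      congr 2
      · omega
      · congr 1; omega
    · intro t ht; simp only [hY]; rw [if_neg (by omega : ¬ (h' ≤ t ∧ _))]; simp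
    · intro t ht; simp only [hY]; rw [if_neg (by omega)]; simp
  have hP' : ∀ h < H, ∀ h' < H,
      ‖∑ t ∈ Finset.range (N + H), Y t h * starRingEnd ℂ (Y t h')‖ = ρ (Nat.dist h h') := by
    intro h hh h' hh'
    rcases le_total h h' with hle | hle
    · exact hP h h' hle hh'
    · rw [Nat.dist_comm, ← hP h' h hle hh, ← RCLike.norm_conj, map_sum]
      congr 1
      refine Finset.sum_congr rfl fun t _ => ?_
      rw [map_mul, Complex.conj_conj, mul_comm]
  set w : ℕ → ℂ := fun t => ∑ h ∈ Finset.range H, Y t h with hw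
  have hwS : ∑ t ∈ Finset.range (N + H), w t = H * ∑ n ∈ Finset.range N, z n := by
    simp only [hw]
    rw [Finset.sum_comm, Finset.sum_congr rfl fun h hh => hYS h (Finset.mem_range.1 hh)]
    simp
  have hw2 : ∑ t ∈ Finset.range (N + H), ‖w t‖ ^ 2 ≤
      H * (ρ 0 + 2 * ∑ j ∈ Finset.range (H - 1), ρ (j + 1)) := by
    have e : ((∑ t ∈ Finset.range (N + H), ‖w t‖ ^ 2 : ℝ) : ℂ) =
        ∑ h ∈ Finset.range H, ∑ h' ∈ Finset.range H,
          ∑ t ∈ Finset.range (N + H), Y t h * starRingEnd ℂ (Y t h') := by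
      push_cast
      rw [Finset.sum_congr rfl fun h _ => Finset.sum_comm, Finset.sum_comm]
      refine Finset.sum_congr rfl fun t _ => ?_
      rw [← Complex.mul_conj', hw, map_sum, Finset.sum_mul_sum]
    have e2 : ∑ t ∈ Finset.range (N + H), ‖w t‖ ^ 2 =
        ‖((∑ t ∈ Finset.range (N + H), ‖w t‖ ^ 2 : ℝ) : ℂ)‖ := by
      rw [Complex.norm_real, Real.norm_of_nonneg (Finset.sum_nonneg fun _ _ => by positivity)]
    rw [e2, e]
    calc _ ≤ ∑ h ∈ Finset.range H, (ρ 0 + 2 * ∑ j ∈ Finset.range (H - 1), ρ (j + 1)) := by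
          refine norm_sum_le_of_le _ fun h hh => ?_
          have hh := Finset.mem_range.1 hh
          refine le_trans ?_ (sum_range_dist_le (ρ := ρ) (fun m => norm_nonneg _) hh)
          exact norm_sum_le_of_le _ fun h' hh' => (hP' h hh h' (Finset.mem_range.1 hh')).le
      _ = _ := by rw [Finset.sum_const, Finset.card_range, nsmul_eq_mul]
  have hcs : ‖∑ t ∈ Finset.range (N + H), w t‖ ^ 2 ≤
      (N + H : ℝ) * ∑ t ∈ Finset.range (N + H), ‖w t‖ ^ 2 := by
    have := sq_sum_le_card_mul_sum_sq (s := Finset.range (N + H)) (f := fun t => ‖w t‖)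
    rw [Finset.card_range] at this
    push_cast at this
    refine le_trans ?_ this
    gcongr
    exact norm_sum_le _ _
  rw [hwS, norm_mul, mul_pow, Complex.norm_natCast] at hcs
  have hHp : (0 : ℝ) < H := by exact_mod_cast hH
  have hHN' : (H : ℝ) ≤ N := by exact_mod_cast hHN
  have e0 : ‖∑ n ∈ Finset.range N, z n * starRingEnd ℂ (z n)‖ = ρ 0 := by simp [hρ]
  rw [e0]
  change _ ≤ 2 * N / H * (ρ 0 + 2 * ∑ j ∈ Finset.range (H - 1), ρ (j + 1))
  set B := ρ 0 + 2 * ∑ j ∈ Finset.range (H - 1), ρ (j + 1) with hB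
  have hB0 : 0 ≤ B := add_nonneg (norm_nonneg _)
    (mul_nonneg zero_le_two (Finset.sum_nonneg fun _ _ => norm_nonneg _))
  have h3 : (H : ℝ) ^ 2 * ‖∑ n ∈ Finset.range N, z n‖ ^ 2 ≤ (2 * N) * (H * B) :=
    hcs.trans (mul_le_mul (by linarith) hw2 (Finset.sum_nonneg fun _ _ => by positivity)
      (by positivity))
  rw [div_mul_eq_mul_div, le_div_iff₀ hHp]
  refine le_of_mul_le_mul_left ?_ hHp
  linarith

lemma iterate_fwdDiff_shift_sub (f : ℕ → ℝ) (m k n : ℕ) :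
    (fwdDiff 1)^[k] (fun n => f (n + m) - f n) n =
      (fwdDiff 1)^[k] f (n + m) - (fwdDiff 1)^[k] f n := by
  induction k generalizing n with
  | zero => rfl
  | succ k ih =>
    simp only [Function.iterate_succ_apply', fwdDiff, ih]
    rw [add_right_comm n m 1]; ring

lemma iterate_fwdDiff_add_sub (f : ℕ → ℝ) (m k n : ℕ) :
    (fwdDiff 1)^[k] f (n + m) - (fwdDiff 1)^[k] f n =
      ∑ i ∈ Finset.range m, (fwdDiff 1)^[k + 1] f (n + i) := by
  have h := Finset.sum_range_sub (fun i => (fwdDiff 1)^[k] f (n + i)) m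
  rw [add_zero] at h
  rw [← h]
  refine Finset.sum_congr rfl fun i _ => ?_
  rw [Function.iterate_succ_apply', fwdDiff, add_assoc]

lemma sum_range_rpow_neg_le {s : ℝ} (hs : s ≤ 1 / 2) (H : ℕ) :
    ∑ j ∈ Finset.range (H - 1), ((j + 1 : ℕ) : ℝ) ^ (-s) ≤ 2 * (H : ℝ) ^ (1 - s) := by
  have h1 : ∀ M : ℕ, ∑ j ∈ Finset.range M, ((j + 1 : ℕ) : ℝ) ^ (-s) ≤ 2 * (M : ℝ) ^ (1 - s) := by
    intro M
    have hsq : ∀ M : ℕ, ∑ j ∈ Finset.range M, 1 / √((j + 1 : ℕ) : ℝ) ≤ 2 * √M := by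
      intro M
      induction M with
      | zero => simp
      | succ M ih =>
        rw [Finset.sum_range_succ]
        have a1 : 0 < √((M + 1 : ℕ) : ℝ) := Real.sqrt_pos.2 (by positivity)
        have a2 : √((M + 1 : ℕ) : ℝ) ^ 2 = M + 1 := by rw [Real.sq_sqrt (by positivity)]; push_cast; rfl
        have a3 : √(M : ℝ) ^ 2 = M := Real.sq_sqrt (by positivity)
        have a4 : 1 / √((M + 1 : ℕ) : ℝ) ≤ 2 * √((M + 1 : ℕ) : ℝ) - 2 * √(M : ℝ) := by
          rw [div_le_iff₀ a1]
          nlinarith [sq_nonneg (√((M + 1 : ℕ) : ℝ) - √(M : ℝ))]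
        linarith
    rcases Nat.eq_zero_or_pos M with rfl | hM
    · simp; positivity
    have hMp : (0 : ℝ) < M := by exact_mod_cast hM
    calc _ ≤ ∑ j ∈ Finset.range M, (M : ℝ) ^ (1 / 2 - s) * (1 / √((j + 1 : ℕ) : ℝ)) := by
          refine Finset.sum_le_sum fun j hj => ?_
          have hjM : ((j + 1 : ℕ) : ℝ) ≤ M := by exact_mod_cast Finset.mem_range.1 hj
          have hj0 : (0 : ℝ) < ((j + 1 : ℕ) : ℝ) := by positivity
          have e : 1 / √((j + 1 : ℕ) : ℝ) = ((j + 1 : ℕ) : ℝ) ^ (-(1 / 2) : ℝ) := by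
            rw [Real.sqrt_eq_rpow, Real.rpow_neg hj0.le, one_div]
          rw [e, show -s = (1 / 2 - s) + -(1 / 2) by ring, Real.rpow_add hj0]
          gcongr
      _ = (M : ℝ) ^ (1 / 2 - s) * ∑ j ∈ Finset.range M, 1 / √((j + 1 : ℕ) : ℝ) := by
          rw [Finset.mul_sum]
      _ ≤ (M : ℝ) ^ (1 / 2 - s) * (2 * √M) := by gcongr; exact hsq M
      _ = _ := by
          rw [Real.sqrt_eq_rpow, show 1 - s = (1 / 2 - s) + 1 / 2 by ring, Real.rpow_add hMp]; ring
  refine (h1 _).trans ?_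
  gcongr
  · linarith
  · omega

lemma norm_sum_sq_le_diff_test {N H : ℕ} (f : ℕ → ℝ) (hH : 0 < H) (hHN : H ≤ N)
    {D lam s b : ℝ} (h0 : 0 < lam) (hs0 : 0 ≤ s) (hs : s ≤ 1 / 2) (hD : 0 ≤ D)
    (h : ∀ m, 0 < m → m < H → ‖∑ n ∈ Finset.range (N - m), unitExp (f (n + m) - f n)‖ ≤
      D * (N * (m * lam) ^ s + (N : ℝ) ^ b * (m * lam) ^ (-s))) :
    ‖∑ n ∈ Finset.range N, unitExp (f n)‖ ^ 2 ≤ 2 * N ^ 2 / H + 4 * D * N ^ 2 * (H * lam) ^ s +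
      8 * D * (N * (N : ℝ) ^ b) * (H * lam) ^ (-s) := by
  have hW := norm_sum_sq_le_correlations (fun n => unitExp (f n)) hH hHN
  have hHp : (0 : ℝ) < H := by exact_mod_cast hH
  have e1 : ∀ m n, unitExp (f (n + m)) * starRingEnd ℂ (unitExp (f n)) =
      unitExp (f (n + m) - f n) := by
    intro m n; rw [← unitExp_neg, ← unitExp_add, sub_eq_add_neg]
  have e2 : ‖∑ n ∈ Finset.range N, unitExp (f n) * starRingEnd ℂ (unitExp (f n))‖ ≤ N := by
    have := norm_sum_unitExp_le (fun n => f n - f n) N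
    refine le_of_eq_of_le ?_ this
    congr 1
    exact Finset.sum_congr rfl fun n _ => e1 0 n
  have e3 : ∑ j ∈ Finset.range (H - 1),
      ‖∑ n ∈ Finset.range (N - (j + 1)), unitExp (f (n + (j + 1))) *
        starRingEnd ℂ (unitExp (f n))‖ ≤
      D * (N * (H * (H * lam) ^ s) + (N : ℝ) ^ b * (2 * H * (H * lam) ^ (-s))) := by
    calc _ ≤ ∑ j ∈ Finset.range (H - 1), (D * (N * (H * lam) ^ s) +
          D * (N : ℝ) ^ b * lam ^ (-s) * ((j + 1 : ℕ) : ℝ) ^ (-s)) := by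
          refine Finset.sum_le_sum fun j hj => ?_
          have hj := Finset.mem_range.1 hj
          simp_rw [e1]
          refine (h (j + 1) (by omega) (by omega)).trans ?_
          rw [Real.mul_rpow (y := lam) (z := -s) (by positivity) h0.le]
          have : ((j + 1 : ℕ) : ℝ) ≤ H := by exact_mod_cast (by omega : j + 1 ≤ H)
          have : (((j + 1 : ℕ) : ℝ) * lam) ^ s ≤ (H * lam) ^ s := by gcongr
          have : D * (N * (((j + 1 : ℕ) : ℝ) * lam) ^ s) ≤ D * (N * (H * lam) ^ s) := by gcongr
          linarith
      _ = (H - 1 : ℕ) * (D * (N * (H * lam) ^ s)) + D * (N : ℝ) ^ b * lam ^ (-s) *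
          ∑ j ∈ Finset.range (H - 1), ((j + 1 : ℕ) : ℝ) ^ (-s) := by
          rw [Finset.sum_add_distrib, Finset.mul_sum]; simp
      _ ≤ H * (D * (N * (H * lam) ^ s)) + D * (N : ℝ) ^ b * lam ^ (-s) *
          (2 * (H : ℝ) ^ (1 - s)) := by
          gcongr
          · omega
          · exact sum_range_rpow_neg_le hs H
      _ = _ := by
          rw [Real.mul_rpow (z := -s) hHp.le h0.le, sub_eq_add_neg, Real.rpow_add hHp, Real.rpow_one]
          ring
  calc _ ≤ 2 * N / H * (N + 2 * (D * (N * (H * (H * lam) ^ s) +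
        (N : ℝ) ^ b * (2 * H * (H * lam) ^ (-s))))) := by
        refine hW.trans ?_
        gcongr
    _ = _ := by field_simp; ring

lemma le_mul_add_of_sq_le {D P R S x y z : ℝ} (hD : 1 ≤ D) (hP : 0 ≤ P) (hR : 0 ≤ R) (hS : 0 ≤ S)
    (hx : x ≤ 4 * P ^ 2) (hy : y ≤ P ^ 2) (hz : z ≤ 2 * R ^ 2)
    (h : S ^ 2 ≤ x + 4 * D * y + 8 * D * z) : S ≤ (4 + 32 * D) * (P + R) := by
  have h1 : 4 * D * y ≤ 4 * D * P ^ 2 := by gcongr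
  have h2 : 8 * D * z ≤ 8 * D * (2 * R ^ 2) := by gcongr
  have h3 : S ^ 2 ≤ (4 + 32 * D) * (P + R) ^ 2 := by
    nlinarith [mul_nonneg hP hR, mul_nonneg (by linarith : 0 ≤ D) (sq_nonneg P),
      mul_nonneg (by linarith : 0 ≤ D) (sq_nonneg R),
      mul_nonneg (by linarith : 0 ≤ D) (mul_nonneg hP hR)]
  have h4 : S ^ 2 ≤ ((4 + 32 * D) * (P + R)) ^ 2 := by
    rw [mul_pow]
    refine h3.trans ?_
    gcongr
    exact le_self_pow₀ (by linarith) two_ne_zero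
  exact (sq_le_sq₀ hS (by positivity)).1 h4

/-- The `k`-th derivative test of van der Corput, for `k`-th differences. -/
lemma norm_sum_unitExp_le_of_iterate_fwdDiff {k : ℕ} (hk : 2 ≤ k) {A : ℝ} (hA : 1 ≤ A) :
    ∃ C : ℝ, 1 ≤ C ∧ ∀ (N : ℕ) (f : ℕ → ℝ) (lam : ℝ), 0 < lam →
      (∀ n < N, lam ≤ (fwdDiff 1)^[k] f n ∧ (fwdDiff 1)^[k] f n ≤ A * lam) →
      ‖∑ n ∈ Finset.range N, unitExp (f n)‖ ≤ C * (N * lam ^ (1 / ((2 : ℝ) ^ k - 2)) +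
        (N : ℝ) ^ (1 - 4 / (2 : ℝ) ^ k) * lam ^ (-(1 / ((2 : ℝ) ^ k - 2)))) := by
  induction k, hk using Nat.le_induction with
  | base =>
    refine ⟨28 * A, by linarith, fun N f lam h0 h => ?_⟩
    have := norm_sum_unitExp_le_of_second_diff hA N f h0 (fun n hn => (h n hn).1)
      (fun n hn => (h n hn).2)
    norm_num
    rw [Real.rpow_neg h0.le, ← one_div, ← Real.sqrt_eq_rpow]
    simpa using this
  | succ k hk ih =>
    obtain ⟨D, hD1, ih⟩ := ih
    have ha4 : (4 : ℝ) ≤ 2 ^ k := by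
      calc (4 : ℝ) = 2 ^ 2 := by norm_num
        _ ≤ 2 ^ k := pow_le_pow_right₀ (by norm_num) hk
    rw [pow_succ]
    set a : ℝ := 2 ^ k with ha
    set s : ℝ := 1 / (a - 2) with hs
    set u : ℝ := 1 / (a * 2 - 2) with hu
    have hs0 : 0 < s := by rw [hs]; apply one_div_pos.2; linarith
    have hs1 : s ≤ 1 / 2 := by rw [hs]; apply one_div_le_one_div_of_le <;> linarith
    have hu0 : 0 < u := by rw [hu]; apply one_div_pos.2; linarith
    have hsu : (1 - 2 * u) * s = 2 * u := by
      have h1 : a - 2 ≠ 0 := by linarith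
      have h2 : a - 1 ≠ 0 := by linarith
      rw [hs, hu, show a * 2 - 2 = 2 * (a - 1) by ring]; field_simp; ring
    have ha2 : 4 / a ≤ 1 := by rw [div_le_one (by linarith)]; linarith
    refine ⟨4 + 32 * D, by linarith, fun N f lam h0 h => ?_⟩
    rcases Nat.eq_zero_or_pos N with rfl | hN
    · simp; positivity
    have hNp : (1 : ℝ) ≤ N := by exact_mod_cast hN
    set P := (N : ℝ) * lam ^ u with hP
    set R := (N : ℝ) ^ (1 - 4 / (a * 2)) * lam ^ (-u) with hR
    have hP0 : 0 < P := by positivity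
    have hR0 : 0 < R := by positivity
    have htriv := norm_sum_unitExp_le f N
    rcases le_or_gt 1 lam with hl | hl
    · have : 1 ≤ lam ^ u := Real.one_le_rpow hl hu0.le
      nlinarith
    set y := lam ^ (-(2 * u)) with hy
    have hy1 : 1 ≤ y := Real.one_le_rpow_of_pos_of_le_one_of_nonpos h0 hl.le (by linarith)
    rcases lt_or_ge (N : ℝ) y with hNy | hNy
    · have h1 : (N : ℝ) ^ (1 / 2 : ℝ) ≤ lam ^ (-u) := by
        have : lam ^ (-u) = y ^ (1 / 2 : ℝ) := by
          rw [hy, ← Real.rpow_mul h0.le]; congr 1; ring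
        rw [this]; gcongr
      have h2 : (N : ℝ) ≤ R := by
        calc (N : ℝ) = (N : ℝ) ^ (1 : ℝ) := (Real.rpow_one _).symm
          _ ≤ (N : ℝ) ^ ((1 - 4 / (a * 2)) + 1 / 2) := by
              apply Real.rpow_le_rpow_of_exponent_le hNp
              have : 4 / (a * 2) = 4 / a / 2 := by field_simp
              rw [this]; linarith
          _ = (N : ℝ) ^ (1 - 4 / (a * 2)) * (N : ℝ) ^ (1 / 2 : ℝ) := Real.rpow_add (by linarith) _ _
          _ ≤ R := by rw [hR]; gcongr
      nlinarith
    set H := ⌊y⌋₊ with hH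
    have hHy : (H : ℝ) ≤ y := Nat.floor_le (by linarith)
    have hH0 : 0 < H := Nat.floor_pos.2 hy1
    have hH1 : (1 : ℝ) ≤ H := by exact_mod_cast hH0
    have hyH : y / 2 ≤ H := by have := Nat.lt_floor_add_one y; rw [← hH] at this; linarith
    have hHN : H ≤ N := by exact_mod_cast hHy.trans hNy
    have hmain := norm_sum_sq_le_diff_test f hH0 hHN (D := D) (b := 1 - 4 / a) h0 hs0.le hs1
      (by linarith) (fun m hm hmH => by
        have hmp : (0 : ℝ) < m := by exact_mod_cast hm
        refine (ih (N - m) (fun n => f (n + m) - f n) (m * lam) (by positivity)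
          (fun n hn => ?_)).trans ?_
        · rw [iterate_fwdDiff_shift_sub, iterate_fwdDiff_add_sub]
          constructor
          · have := Finset.card_nsmul_le_sum (Finset.range m)
              (fun i => (fwdDiff 1)^[k + 1] f (n + i)) lam
              (fun i hi => (h (n + i) (by have := Finset.mem_range.1 hi; omega)).1)
            simpa using this
          · have := Finset.sum_le_card_nsmul (Finset.range m)
              (fun i => (fwdDiff 1)^[k + 1] f (n + i)) (A * lam)
              (fun i hi => (h (n + i) (by have := Finset.mem_range.1 hi; omega)).2)
            simp only [Finset.card_range, nsmul_eq_mul] at this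
            linarith
        · have : ((N - m : ℕ) : ℝ) ≤ N := by exact_mod_cast Nat.sub_le _ _
          gcongr)
    have b1 : 2 * (N : ℝ) ^ 2 / H ≤ 4 * P ^ 2 := by
      have : P ^ 2 = N ^ 2 / y := by
        rw [hP, mul_pow, ← Real.rpow_natCast (lam ^ u), ← Real.rpow_mul h0.le, hy,
          Real.rpow_neg h0.le, div_inv_eq_mul]
        congr 2; push_cast; ring
      rw [this, div_le_iff₀ (by linarith)]
      have : 4 * ((N : ℝ) ^ 2 / y) * (y / 2) ≤ 4 * ((N : ℝ) ^ 2 / y) * H := by gcongr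
      have e : 4 * ((N : ℝ) ^ 2 / y) * (y / 2) = 2 * N ^ 2 := by field_simp; norm_num
      linarith
    have hyl : (y * lam) ^ s = lam ^ (2 * u) := by
      rw [hy, ← Real.rpow_add_one h0.ne', ← Real.rpow_mul h0.le]
      congr 1; linarith
    have b2 : (N : ℝ) ^ 2 * (H * lam) ^ s ≤ P ^ 2 := by
      rw [hP, mul_pow]
      gcongr
      calc (H * lam) ^ s ≤ (y * lam) ^ s := by gcongr
        _ = (lam ^ u) ^ 2 := by
          rw [hyl, ← Real.rpow_natCast (lam ^ u), ← Real.rpow_mul h0.le]; congr 1; push_cast; ring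
    have b3 : (N * (N : ℝ) ^ (1 - 4 / a)) * (H * lam) ^ (-s) ≤ 2 * R ^ 2 := by
      have c1 : (N * (N : ℝ) ^ (1 - 4 / a)) = ((N : ℝ) ^ (1 - 4 / (a * 2))) ^ 2 := by
        rw [← Real.rpow_one_add' (by linarith) (by linarith), ← Real.rpow_natCast,
          ← Real.rpow_mul (by linarith)]
        congr 1; push_cast; field_simp; ring
      rw [c1, hR, mul_pow]
      have c2 : (H * lam) ^ (-s) ≤ 2 * (lam ^ (-u)) ^ 2 := by
        calc (H * lam) ^ (-s) ≤ (y / 2 * lam) ^ (-s) := by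
              apply Real.rpow_le_rpow_of_nonpos (by positivity) (by gcongr) (by linarith)
          _ = (1 / 2) ^ (-s) * ((y * lam) ^ s)⁻¹ := by
              rw [show y / 2 * lam = (1 / 2) * (y * lam) by ring,
                Real.mul_rpow (by norm_num) (by positivity), Real.rpow_neg (x := y * lam) (by positivity)]
          _ ≤ 2 * ((y * lam) ^ s)⁻¹ := by
              gcongr
              rw [one_div, Real.inv_rpow (by norm_num), Real.rpow_neg (by norm_num), inv_inv]
              calc (2 : ℝ) ^ s ≤ 2 ^ (1 : ℝ) :=
                    Real.rpow_le_rpow_of_exponent_le (by norm_num) (by linarith)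
                _ = 2 := Real.rpow_one _
          _ = _ := by
              rw [hyl, ← Real.rpow_natCast (lam ^ (-u)), ← Real.rpow_mul h0.le,
                ← Real.rpow_neg h0.le]
              congr 2; push_cast; ring
      calc _ ≤ ((N : ℝ) ^ (1 - 4 / (a * 2))) ^ 2 * (2 * (lam ^ (-u)) ^ 2) := by gcongr
        _ = _ := by ring
    exact le_mul_add_of_sq_le (by linarith) hP0.le hR0.le (norm_nonneg _) b1 b2 b3
      (by rw [mul_assoc (4 * D), mul_assoc (8 * D)] at hmain; exact hmain)

lemma hasDerivAt_iterate_fwdDiff_rpow (j : ℕ) (s : ℝ) {x : ℝ} (hx : 0 < x) :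
    HasDerivAt ((fwdDiff (1 : ℝ))^[j] (fun y : ℝ => y ^ s))
      (s * (fwdDiff (1 : ℝ))^[j] (fun y : ℝ => y ^ (s - 1)) x) x := by
  induction j generalizing x with
  | zero => simpa using Real.hasDerivAt_rpow_const (p := s) (Or.inl hx.ne')
  | succ j ih =>
    rw [Function.iterate_succ', Function.comp_apply, Function.comp_apply]
    have h1 := (ih (x := x + 1) (by linarith)).comp_add_const x 1
    have := h1.sub (ih hx)
    rw [← mul_sub] at this
    exact this

lemma exists_iterate_fwdDiff_rpow_eq (j : ℕ) (s : ℝ) {x : ℝ} (hx : 0 < x) :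
    ∃ ξ, x ≤ ξ ∧ ξ ≤ x + j ∧ (fwdDiff (1 : ℝ))^[j] (fun y : ℝ => y ^ s) x =
      (∏ i ∈ Finset.range j, (s - i)) * ξ ^ (s - j) := by
  induction j generalizing s x with
  | zero => exact ⟨x, le_rfl, by simp, by simp⟩
  | succ j ih =>
    obtain ⟨η, hη, hη'⟩ := exists_hasDerivAt_eq_slope ((fwdDiff (1 : ℝ))^[j] (fun y : ℝ => y ^ s))
      (fun y => s * (fwdDiff (1 : ℝ))^[j] (fun y : ℝ => y ^ (s - 1)) y) (lt_add_one x)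
      (fun y hy => (hasDerivAt_iterate_fwdDiff_rpow j s
        (by linarith [hy.1])).continuousAt.continuousWithinAt)
      (fun y hy => hasDerivAt_iterate_fwdDiff_rpow j s (by linarith [hy.1]))
    obtain ⟨ξ, h1, h2, h3⟩ := ih (s - 1) (x := η) (by linarith [hη.1])
    refine ⟨ξ, by linarith [hη.1], by push_cast; linarith [hη.2], ?_⟩
    rw [Function.iterate_succ_apply', fwdDiff, Finset.prod_range_succ']
    rw [add_sub_cancel_left, div_one] at hη'
    rw [← hη', h3]
    have e : s - 1 - (j : ℝ) = s - ((j + 1 : ℕ) : ℝ) := by push_cast; ring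
    rw [e]
    push_cast
    simp only [sub_zero, sub_sub, add_comm (1 : ℝ)]
    ring

lemma iterate_fwdDiff_comp_natCast (F : ℝ → ℝ) (c : ℝ) (a j n : ℕ) :
    (fwdDiff 1)^[j] (fun n : ℕ => c * F ((a + n : ℕ) : ℝ)) n =
      c * (fwdDiff (1 : ℝ))^[j] F ((a + n : ℕ) : ℝ) := by
  induction j generalizing n with
  | zero => rfl
  | succ j ih =>
    simp only [Function.iterate_succ_apply', fwdDiff, ih]
    rw [← mul_sub]; push_cast; simp only [add_assoc]

lemma exists_iterate_fwdDiff_mul_rpow_eq (r c : ℝ) {K : ℝ} (hK : 3 ≤ K) (j n : ℕ)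
    (hn : n < ⌈2 * K⌉₊ - ⌈K⌉₊) :
    ∃ ξ, K ≤ ξ ∧ ξ ≤ (2 + j) * K ∧
      (fwdDiff 1)^[j] (fun n : ℕ => c * ((⌈K⌉₊ + n : ℕ) : ℝ) ^ r) n =
        c * ((∏ i ∈ Finset.range j, (r - i)) * ξ ^ (r - j)) := by
  have h1 : K ≤ ((⌈K⌉₊ + n : ℕ) : ℝ) := by
    push_cast; have := Nat.le_ceil K; have : (0 : ℝ) ≤ n := by positivity
    linarith
  have h2 : ((⌈K⌉₊ + n : ℕ) : ℝ) < 2 * K := Nat.lt_ceil.1 (by omega)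
  obtain ⟨ξ, a1, a2, a3⟩ := exists_iterate_fwdDiff_rpow_eq j r (x := ((⌈K⌉₊ + n : ℕ) : ℝ))
    (by linarith)
  refine ⟨ξ, by linarith, ?_, ?_⟩
  · have : (0 : ℝ) ≤ j := by positivity
    nlinarith
  · rw [iterate_fwdDiff_comp_natCast (fun y => y ^ r), a3]

lemma rpow_mem_of_mem_dilate {B : ℝ} (hB : 1 ≤ B) (s : ℝ) : ∃ m M : ℝ, 0 < m ∧ m ≤ M ∧
    ∀ K x : ℝ, 0 < K → K ≤ x → x ≤ B * K → m * K ^ s ≤ x ^ s ∧ x ^ s ≤ M * K ^ s := by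
  rcases le_total 0 s with hs | hs
  · refine ⟨1, B ^ s, one_pos, Real.one_le_rpow hB hs, fun K x hK h1 h2 => ⟨?_, ?_⟩⟩
    · rw [one_mul]; gcongr
    · rw [← Real.mul_rpow (by linarith) hK.le]
      exact Real.rpow_le_rpow (by linarith) h2 hs
  · refine ⟨B ^ s, 1, by positivity, Real.rpow_le_one_of_one_le_of_nonpos hB hs,
      fun K x hK h1 h2 => ⟨?_, ?_⟩⟩
    · rw [← Real.mul_rpow (by linarith) hK.le]
      exact Real.rpow_le_rpow_of_nonpos (by linarith) h2 hs
    · rw [one_mul]; exact Real.rpow_le_rpow_of_nonpos hK h1 hs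

lemma card_dyadic_le {K : ℝ} (hK : 3 ≤ K) : ((⌈2 * K⌉₊ - ⌈K⌉₊ : ℕ) : ℝ) ≤ 2 * K := by
  have h1 := Nat.ceil_lt_add_one (show 0 ≤ 2 * K by linarith)
  have h2 := Nat.le_ceil K
  have h3 : ⌈K⌉₊ ≤ ⌈2 * K⌉₊ := Nat.ceil_mono (by linarith)
  rw [Nat.cast_sub h3]
  linarith

lemma norm_powSum_le_diff_test (r : ℝ) (hri : ∀ m : ℤ, r ≠ m) {j : ℕ} (hj : 2 ≤ j) :
    ∃ C : ℝ, 1 ≤ C ∧ ∀ K c : ℝ, 3 ≤ K → 0 < c →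
      ‖∑ n ∈ Finset.range (⌈2 * K⌉₊ - ⌈K⌉₊), unitExp (c * ((⌈K⌉₊ + n : ℕ) : ℝ) ^ r)‖ ≤
        C * (K * (c * K ^ (r - j)) ^ (1 / ((2 : ℝ) ^ j - 2)) +
          K ^ (1 - 4 / (2 : ℝ) ^ j) * (c * K ^ (r - j)) ^ (-(1 / ((2 : ℝ) ^ j - 2)))) := by
  obtain ⟨m, M, hm, hmM, hmem⟩ := rpow_mem_of_mem_dilate (B := 2 + j)
    (by have : (0 : ℝ) ≤ j := by positivity
        linarith) (r - j)
  obtain ⟨D, hD, hT⟩ := norm_sum_unitExp_le_of_iterate_fwdDiff hj (A := M / m)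
    ((one_le_div hm).2 hmM)
  have ha4 : (4 : ℝ) ≤ 2 ^ j := by
    calc (4 : ℝ) = 2 ^ 2 := by norm_num
      _ ≤ 2 ^ j := pow_le_pow_right₀ (by norm_num) hj
  set a : ℝ := 2 ^ j with ha
  set u : ℝ := 1 / (a - 2) with hu
  have hu0 : 0 < u := by rw [hu]; apply one_div_pos.2; linarith
  have ha2 : 0 ≤ 1 - 4 / a := by rw [sub_nonneg, div_le_one (by linarith)]; linarith
  set p : ℝ := ∏ i ∈ Finset.range j, (r - i) with hp
  have hp0 : p ≠ 0 := Finset.prod_ne_zero_iff.2 fun i _ => by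
    have := hri i; rw [sub_ne_zero]; exact_mod_cast this
  set b : ℝ := m * |p| with hb
  have hb0 : 0 < b := mul_pos hm (abs_pos.2 hp0)
  refine ⟨D * (2 * b ^ u + 2 * b ^ (-u) + 1), ?_, fun K c hK hc => ?_⟩
  · have : 0 < b ^ u := by positivity
    have : 0 < b ^ (-u) := by positivity
    nlinarith
  set N := ⌈2 * K⌉₊ - ⌈K⌉₊ with hN
  have hNK : (N : ℝ) ≤ 2 * K := card_dyadic_le hK
  set l := c * K ^ (r - j) with hl
  have hl0 : 0 < l := by positivity
  have hmain : ‖∑ n ∈ Finset.range N, unitExp (c * ((⌈K⌉₊ + n : ℕ) : ℝ) ^ r)‖ ≤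
      D * (N * (b * l) ^ u + (N : ℝ) ^ (1 - 4 / a) * (b * l) ^ (-u)) := by
    have key : ∀ c', |c'| = c → 0 < c' * p → ‖∑ n ∈ Finset.range N,
        unitExp (c' * ((⌈K⌉₊ + n : ℕ) : ℝ) ^ r)‖ ≤
          D * (N * (b * l) ^ u + (N : ℝ) ^ (1 - 4 / a) * (b * l) ^ (-u)) := by
      intro c' hc' hcp
      refine hT N _ (b * l) (by positivity) fun n hn => ?_
      obtain ⟨ξ, h1, h2, h3⟩ := exists_iterate_fwdDiff_mul_rpow_eq r c' hK j n hn
      have h4 : c' * p = c * |p| := by rw [← abs_of_pos hcp, abs_mul, hc']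
      rw [h3, ← hp, ← mul_assoc c', h4]
      obtain ⟨h5, h6⟩ := hmem K ξ (by linarith) h1 h2
      have hcp' : 0 ≤ c * |p| := by positivity
      constructor
      · calc b * l = c * |p| * (m * K ^ (r - j)) := by rw [hb, hl]; ring
          _ ≤ _ := by gcongr
      · calc _ ≤ c * |p| * (M * K ^ (r - j)) := by gcongr
          _ = _ := by rw [hb, hl]; field_simp
    rcases lt_or_gt_of_ne hp0 with hneg | hpos
    · have := key (-c) (by rw [abs_neg, abs_of_pos hc]) (by nlinarith)
      simp only [neg_mul] at this
      rwa [norm_sum_unitExp_neg] at this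
    · exact key c (abs_of_pos hc) (by positivity)
  refine hmain.trans ?_
  have hD0 : 0 ≤ D := by linarith
  rw [mul_assoc D]
  refine mul_le_mul_of_nonneg_left ?_ hD0
  rw [Real.mul_rpow hb0.le hl0.le, Real.mul_rpow hb0.le hl0.le]
  have hK1 : (N : ℝ) ^ (1 - 4 / a) ≤ 2 * K ^ (1 - 4 / a) := by
    calc (N : ℝ) ^ (1 - 4 / a) ≤ (2 * K) ^ (1 - 4 / a) := by gcongr
      _ = 2 ^ (1 - 4 / a) * K ^ (1 - 4 / a) := Real.mul_rpow (by norm_num) (by linarith)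
      _ ≤ 2 ^ (1 : ℝ) * K ^ (1 - 4 / a) := by
          gcongr
          · norm_num
          · have : 0 < 4 / a := by positivity
            linarith
      _ = _ := by rw [Real.rpow_one]
  have i1 : 0 < l ^ u := by positivity
  have i2 : 0 < l ^ (-u) := by positivity
  have i3 : 0 < b ^ u := by positivity
  have i4 : 0 < b ^ (-u) := by positivity
  have i5 : 0 < K ^ (1 - 4 / a) := by have : 0 < K := by linarith
                                      positivity
  calc _ ≤ 2 * K * (b ^ u * l ^ u) + 2 * K ^ (1 - 4 / a) * (b ^ (-u) * l ^ (-u)) := by gcongr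
    _ = 2 * b ^ u * (K * l ^ u) + 2 * b ^ (-u) * (K ^ (1 - 4 / a) * l ^ (-u)) := by ring
    _ ≤ (2 * b ^ u + 2 * b ^ (-u) + 1) * (K * l ^ u) +
        (2 * b ^ u + 2 * b ^ (-u) + 1) * (K ^ (1 - 4 / a) * l ^ (-u)) := by
        have : 0 < K := by linarith
        gcongr <;> linarith
    _ = _ := by ring

lemma norm_powSum_le_of_large (r : ℝ) (hri : ∀ m : ℤ, r ≠ m) {c₀ : ℝ} (hc₀ : 0 < c₀) {j : ℕ}
    (hj : 2 ≤ j) :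
    ∃ C : ℝ, 0 < C ∧ ∀ K c : ℝ, 3 ≤ K → 0 < c → c₀ ≤ c * K ^ (r - 1) →
      ‖∑ n ∈ Finset.range (⌈2 * K⌉₊ - ⌈K⌉₊), unitExp (c * ((⌈K⌉₊ + n : ℕ) : ℝ) ^ r)‖ ≤
        C * (K * (c * K ^ (r - j)) ^ (1 / ((2 : ℝ) ^ j - 2))) := by
  induction j, hj using Nat.le_induction with
  | base =>
    obtain ⟨C, hC, hE⟩ := norm_powSum_le_diff_test r hri (le_refl 2)
    refine ⟨C * (1 + 1 / c₀), by positivity, fun K c hK hc hL => ?_⟩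
    have hK0 : 0 < K := by linarith
    refine (hE K c hK hc).trans ?_
    have e : c * K ^ (r - 1) = K * (c * K ^ (r - (2 : ℕ))) := by
      rw [show r - 1 = (r - (2 : ℕ)) + 1 by push_cast; ring, Real.rpow_add_one hK0.ne']; ring
    rw [e] at hL
    set l := c * K ^ (r - (2 : ℕ)) with hl
    have hl0 : 0 < l := by positivity
    norm_num
    have e2 : l ^ (-(1 / 2) : ℝ) = l ^ (1 / 2 : ℝ) / l := by
      rw [show (-(1 / 2) : ℝ) = 1 / 2 - 1 by norm_num, Real.rpow_sub_one hl0.ne']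
    rw [e2, mul_assoc]
    gcongr
    have : l ^ (1 / 2 : ℝ) / l ≤ c₀⁻¹ * (K * l ^ (1 / 2 : ℝ)) := by
      rw [div_le_iff₀ hl0]
      calc l ^ (1 / 2 : ℝ) = c₀⁻¹ * (c₀ * l ^ (1 / 2 : ℝ)) := by field_simp
        _ ≤ c₀⁻¹ * (K * l * l ^ (1 / 2 : ℝ)) := by gcongr
        _ = _ := by ring
    linarith
  | succ j hj ih =>
    obtain ⟨C₁, hC₁, ih⟩ := ih
    obtain ⟨C₂, hC₂, hE⟩ := norm_powSum_le_diff_test r hri (show 2 ≤ j + 1 by omega)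
    refine ⟨C₁ + 2 * C₂, by positivity, fun K c hK hc hL => ?_⟩
    have hK0 : 0 < K := by linarith
    have ha4 : (4 : ℝ) ≤ 2 ^ j := by
      calc (4 : ℝ) = 2 ^ 2 := by norm_num
        _ ≤ 2 ^ j := pow_le_pow_right₀ (by norm_num) hj
    have h1 := ih K c hK hc hL
    have h2 := hE K c hK hc
    have e : c * K ^ (r - j) = c * K ^ (r - (j + 1 : ℕ)) * K := by
      rw [show r - j = (r - (j + 1 : ℕ)) + 1 by push_cast; ring, Real.rpow_add_one hK0.ne']; ring
    rw [e] at h1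
    set l := c * K ^ (r - (j + 1 : ℕ)) with hl
    have hl0 : 0 < l := by positivity
    rw [pow_succ] at h2 ⊢
    set a : ℝ := 2 ^ j with ha
    have ha1 : a - 1 ≠ 0 := by linarith
    have ha2 : a - 2 ≠ 0 := by linarith
    have ha0 : a ≠ 0 := by linarith
    set u : ℝ := 1 / (a * 2 - 2) with hu
    have hu' : u = 1 / (2 * (a - 1)) := by rw [hu]; congr 1; ring
    set s : ℝ := 1 / (a - 2) with hs
    have hu0 : 0 < u := by rw [hu]; apply one_div_pos.2; linarith
    rcases le_total (K ^ (-2 + 2 / a)) l with hcase | hcase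
    · have hlu : K ^ (-(2 / a)) ≤ l ^ (2 * u) := by
        have : (K ^ (-2 + 2 / a)) ^ (2 * u) = K ^ (-(2 / a)) := by
          rw [← Real.rpow_mul hK0.le]; congr 1
          rw [hu']; field_simp; ring
        rw [← this]; gcongr
      have h3 : K ^ (1 - 4 / (a * 2)) * l ^ (-u) ≤ K * l ^ u := by
        calc K ^ (1 - 4 / (a * 2)) * l ^ (-u) = K * K ^ (-(2 / a)) * l ^ (-u) := by
              rw [← Real.rpow_one_add' hK0.le]
              · congr 2; field_simp; ring
              · have : 2 / a ≤ 1 / 2 := by rw [div_le_div_iff₀] <;> linarith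
                linarith
          _ ≤ K * l ^ (2 * u) * l ^ (-u) := by gcongr
          _ = K * l ^ u := by
              rw [mul_assoc, ← Real.rpow_add hl0]; congr 2; ring
      have h4 : 0 < K * l ^ u := by positivity
      nlinarith
    · have hsu : 0 ≤ s - u := by
        rw [sub_nonneg, hs, hu]; apply one_div_le_one_div_of_le <;> linarith
      have h3 : (l * K) ^ s ≤ l ^ u := by
        calc (l * K) ^ s = l ^ u * (l ^ (s - u) * K ^ s) := by
              rw [Real.mul_rpow hl0.le hK0.le, ← mul_assoc, ← Real.rpow_add hl0]; congr 2; ring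
          _ ≤ l ^ u * ((K ^ (-2 + 2 / a)) ^ (s - u) * K ^ s) := by gcongr
          _ = l ^ u := by
              rw [← Real.rpow_mul hK0.le, ← Real.rpow_add hK0]
              have : (-2 + 2 / a) * (s - u) + s = 0 := by
                rw [hs, hu']; field_simp; ring
              rw [this, Real.rpow_zero, mul_one]
      have h4 : 0 < K * l ^ u := by positivity
      calc _ ≤ C₁ * (K * (l * K) ^ s) := h1
        _ ≤ C₁ * (K * l ^ u) := by gcongr
        _ ≤ _ := by nlinarith

lemma norm_powSum_le_of_small {r : ℝ} (hr : 1 < r) {K c : ℝ} (hK : 3 ≤ K) (hc : 0 < c)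
    (h : r * 3 ^ (r - 1) * (c * K ^ (r - 1)) ≤ 1 / 2) :
    ‖∑ n ∈ Finset.range (⌈2 * K⌉₊ - ⌈K⌉₊), unitExp (c * ((⌈K⌉₊ + n : ℕ) : ℝ) ^ r)‖ ≤
      2 * (1 / (c * K ^ (r - 1))) := by
  have hK0 : 0 < K := by linarith
  have hL : 0 < c * K ^ (r - 1) := by positivity
  have h3 : (1 : ℝ) ≤ 3 ^ (r - 1) := Real.one_le_rpow (by norm_num) (by linarith)
  have hd : ∀ n < ⌈2 * K⌉₊ - ⌈K⌉₊, c * K ^ (r - 1) ≤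
      c * ((⌈K⌉₊ + (n + 1) : ℕ) : ℝ) ^ r - c * ((⌈K⌉₊ + n : ℕ) : ℝ) ^ r ∧
      c * ((⌈K⌉₊ + (n + 1) : ℕ) : ℝ) ^ r - c * ((⌈K⌉₊ + n : ℕ) : ℝ) ^ r ≤ 1 / 2 := by
    intro n hn
    obtain ⟨ξ, h1, h2, h4⟩ := exists_iterate_fwdDiff_mul_rpow_eq r c hK 1 n hn
    simp only [Function.iterate_one, fwdDiff, Finset.prod_range_one, Nat.cast_zero, sub_zero,
      Nat.cast_one] at h4
    rw [h4]
    have hξ : K ^ (r - 1) ≤ ξ ^ (r - 1) := by gcongr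
    have hξ0 : 0 < ξ := by linarith
    have hξ2 : ξ ^ (r - 1) ≤ 3 ^ (r - 1) * K ^ (r - 1) := by
      rw [← Real.mul_rpow (by norm_num) hK0.le]
      exact Real.rpow_le_rpow hξ0.le (by push_cast at h2; linarith) (by linarith)
    constructor
    · calc c * K ^ (r - 1) ≤ c * (1 * ξ ^ (r - 1)) := by rw [one_mul]; gcongr
        _ ≤ _ := by gcongr
    · calc c * (r * ξ ^ (r - 1)) ≤ c * (r * (3 ^ (r - 1) * K ^ (r - 1))) := by gcongr
        _ ≤ _ := by linarith
  have hL2 : c * K ^ (r - 1) ≤ 1 / 2 := by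
    have : 1 * 1 * (c * K ^ (r - 1)) ≤ r * 3 ^ (r - 1) * (c * K ^ (r - 1)) := by gcongr
    linarith
  rw [mul_one_div]
  refine norm_sum_unitExp_le_of_monotone (fun n => c * ((⌈K⌉₊ + n : ℕ) : ℝ) ^ r) _ hL
    (fun n hn => ?_) (fun n hn => (hd n hn).1) (fun n hn => by linarith [(hd n hn).2])
  obtain ⟨ξ, h1, h2, h4⟩ := exists_iterate_fwdDiff_mul_rpow_eq r c hK 2 n (by omega)
  have e : (fwdDiff 1)^[2] (fun n : ℕ => c * ((⌈K⌉₊ + n : ℕ) : ℝ) ^ r) n =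
    (c * ((⌈K⌉₊ + (n + 2) : ℕ) : ℝ) ^ r - c * ((⌈K⌉₊ + (n + 1) : ℕ) : ℝ) ^ r) -
    (c * ((⌈K⌉₊ + (n + 1) : ℕ) : ℝ) ^ r - c * ((⌈K⌉₊ + n : ℕ) : ℝ) ^ r) := rfl
  rw [e, Finset.prod_range_succ, Finset.prod_range_one] at h4
  have : 0 ≤ c * ((r - (0 : ℕ)) * (r - (1 : ℕ)) * ξ ^ (r - (2 : ℕ))) := by
    push_cast
    have : 0 < ξ := by linarith
    have : 0 < r - 1 := by linarith
    have : 0 < r - 0 := by linarith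
    positivity
  linarith

/-- The exponent pair bound for the power function. -/
lemma norm_powSum_le_exponent_pair {r : ℝ} (hr : 1 < r) (hri : ∀ m : ℤ, r ≠ m) {j : ℕ}
    (hj : 2 ≤ j) :
    ∃ C : ℝ, 0 < C ∧ ∀ K c : ℝ, 3 ≤ K → 0 < c →
      ‖∑ n ∈ Finset.range (⌈2 * K⌉₊ - ⌈K⌉₊), unitExp (c * ((⌈K⌉₊ + n : ℕ) : ℝ) ^ r)‖ ≤
        C * (K * (c * K ^ (r - j)) ^ (1 / ((2 : ℝ) ^ j - 2)) + 1 / (c * K ^ (r - 1))) := by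
  set c₀ : ℝ := 1 / 2 / (r * 3 ^ (r - 1)) with hc₀
  have hc₀p : 0 < c₀ := by positivity
  obtain ⟨C, hC, h⟩ := norm_powSum_le_of_large r hri hc₀p hj
  refine ⟨C + 2, by linarith, fun K c hK hc => ?_⟩
  have hK0 : 0 < K := by linarith
  have h1 : 0 < K * (c * K ^ (r - j)) ^ (1 / ((2 : ℝ) ^ j - 2)) := by positivity
  have h2 : 0 < 1 / (c * K ^ (r - 1)) := by positivity
  rcases le_total c₀ (c * K ^ (r - 1)) with hL | hL
  · refine (h K c hK hc hL).trans ?_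
    nlinarith
  · refine (norm_powSum_le_of_small hr hK hc ?_).trans ?_
    · rw [hc₀, le_div_iff₀ (by positivity)] at hL; linarith
    · nlinarith

/-- The 1-periodic extension of the second Bernoulli polynomial. -/
noncomputable def periodicBernoulliTwo (x : ℝ) : ℝ := Int.fract x ^ 2 - Int.fract x + 1 / 6

lemma hasSum_periodicBernoulliTwo (x : ℝ) :
    HasSum (fun h : ℕ => 1 / (h : ℝ) ^ 2 * (unitExp (h * x)).re)
      (Real.pi ^ 2 * periodicBernoulliTwo x) := by
  have h := hasSum_one_div_nat_pow_mul_cos one_ne_zero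
    (x := Int.fract x) ⟨Int.fract_nonneg x, (Int.fract_lt_one x).le⟩
  convert h using 1
  · ext n
    have e : (n : ℝ) * x = n * Int.fract x + ((n * ⌊x⌋ : ℤ) : ℝ) := by
      push_cast
      rw [← mul_add, Int.fract_add_floor]
    rw [e, unitExp_add, unitExp_int, mul_one, unitExp, Complex.exp_ofReal_mul_I_re]
    simp only [mul_one]
    congr 2
    ring
  · have e : (Polynomial.map (algebraMap ℚ ℝ) (Polynomial.bernoulli (2 * 1))).eval (Int.fract x) =
        periodicBernoulliTwo x := by
      simp [Polynomial.bernoulli, Finset.sum_range_succ, periodicBernoulliTwo, bernoulli_one,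
        bernoulli_two]
      ring
    have e' : ((2 * 1).factorial : ℝ) = 2 := by norm_num [Nat.factorial]
    rw [e, e']
    ring

lemma periodicBernoulliTwo_add_sub_le {δ : ℝ} (h0 : 0 ≤ δ) (h1 : δ ≤ 1) (x : ℝ) :
    periodicBernoulliTwo (x + δ) - periodicBernoulliTwo x ≤ 2 * δ * saw x + δ ^ 2 := by
  have hs : saw x = Int.fract x - 1 / 2 := rfl
  have hx0 := Int.fract_nonneg x
  have hx1 := Int.fract_lt_one x
  unfold periodicBernoulliTwo
  rw [hs]
  rcases lt_or_ge (Int.fract x + δ) 1 with h | h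
  · have e : Int.fract (x + δ) = Int.fract x + δ :=
      Int.fract_eq_iff.2 ⟨by linarith, h, ⌊x⌋, by rw [← Int.self_sub_floor]; ring⟩
    rw [e]
    nlinarith
  · have e : Int.fract (x + δ) = Int.fract x + δ - 1 :=
      Int.fract_eq_iff.2 ⟨by linarith, by linarith, ⌊x⌋ + 1, by
        rw [← Int.self_sub_floor]; push_cast; ring⟩
    rw [e]
    nlinarith

lemma le_periodicBernoulliTwo_sub_sub {δ : ℝ} (h0 : 0 ≤ δ) (h1 : δ ≤ 1) (x : ℝ) :
    2 * δ * saw x - δ ^ 2 ≤ periodicBernoulliTwo x - periodicBernoulliTwo (x + -δ) := by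
  have hs : saw x = Int.fract x - 1 / 2 := rfl
  have hx0 := Int.fract_nonneg x
  have hx1 := Int.fract_lt_one x
  unfold periodicBernoulliTwo
  rw [hs]
  rcases le_or_gt δ (Int.fract x) with h | h
  · have e : Int.fract (x + -δ) = Int.fract x - δ :=
      Int.fract_eq_iff.2 ⟨by linarith, by linarith, ⌊x⌋, by rw [← Int.self_sub_floor]; ring⟩
    rw [e]
    nlinarith
  · have e : Int.fract (x + -δ) = Int.fract x - δ + 1 :=
      Int.fract_eq_iff.2 ⟨by linarith, by linarith, ⌊x⌋ - 1, by
        rw [← Int.self_sub_floor]; push_cast; ring⟩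
    rw [e]
    nlinarith

lemma norm_unitExp_sub_one_le (x : ℝ) : ‖unitExp x - 1‖ ≤ 7 * min 1 |x| := by
  rw [mul_min_of_nonneg _ _ (by norm_num)]
  refine le_min ?_ ?_
  · calc ‖unitExp x - 1‖ ≤ ‖unitExp x‖ + ‖(1 : ℂ)‖ := norm_sub_le _ _
      _ ≤ 7 * 1 := by rw [norm_unitExp]; norm_num
  · have h := Real.norm_exp_I_mul_ofReal_sub_one_le (x := 2 * Real.pi * x)
    rw [mul_comm Complex.I] at h
    refine h.trans ?_
    rw [Real.norm_eq_abs, abs_mul, abs_of_pos (by positivity)]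
    have := Real.pi_lt_d2
    gcongr
    linarith

/-- Fourier expansion bound for the total increment of the periodic Bernoulli function. -/
lemma abs_sum_periodicBernoulliTwo_sub_le (x : ℕ → ℝ) (N : ℕ) (η : ℝ) {B : ℝ}
    (hB : ∀ M : ℕ, ∑ h ∈ Finset.range M, 1 / (h : ℝ) ^ 2 * (min 1 (h * |η|) *
      ‖∑ n ∈ Finset.range N, unitExp (h * x n)‖) ≤ B) :
    |∑ n ∈ Finset.range N, (periodicBernoulliTwo (x n + η) - periodicBernoulliTwo (x n))| ≤ B := by
  have hs : HasSum (fun h : ℕ => 1 / (h : ℝ) ^ 2 * ((unitExp (h * η) - 1) *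
      ∑ n ∈ Finset.range N, unitExp (h * x n)).re)
      (∑ n ∈ Finset.range N, (Real.pi ^ 2 * periodicBernoulliTwo (x n + η) -
        Real.pi ^ 2 * periodicBernoulliTwo (x n))) := by
    have := hasSum_sum (s := Finset.range N) fun n _ =>
      (hasSum_periodicBernoulliTwo (x n + η)).sub (hasSum_periodicBernoulliTwo (x n))
    refine (funext fun h => ?_ : (fun _ : ℕ => (_ : ℝ)) = _) ▸ this
    rw [Finset.mul_sum, Complex.re_sum, Finset.mul_sum]
    refine Finset.sum_congr rfl fun n _ => ?_
    rw [← mul_sub, ← Complex.sub_re, mul_add, unitExp_add]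
    congr 2
    ring
  have hb : ∀ M : ℕ, |∑ h ∈ Finset.range M, 1 / (h : ℝ) ^ 2 * ((unitExp (h * η) - 1) *
      ∑ n ∈ Finset.range N, unitExp (h * x n)).re| ≤ 7 * B := by
    intro M
    refine (Finset.abs_sum_le_sum_abs _ _).trans
      (le_trans ?_ (mul_le_mul_of_nonneg_left (hB M) (by norm_num)))
    rw [Finset.mul_sum]
    refine Finset.sum_le_sum fun h _ => ?_
    rw [abs_mul, abs_of_nonneg (by positivity : (0 : ℝ) ≤ 1 / (h : ℝ) ^ 2), mul_left_comm]
    refine mul_le_mul_of_nonneg_left ?_ (by positivity)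
    refine (Complex.abs_re_le_norm _).trans ?_
    rw [norm_mul, ← mul_assoc]
    refine mul_le_mul_of_nonneg_right ?_ (norm_nonneg _)
    have := norm_unitExp_sub_one_le (h * η)
    rwa [abs_mul, Nat.abs_cast] at this
  have hl := le_of_tendsto hs.tendsto_sum_nat.abs (Filter.Eventually.of_forall hb)
  simp only [← mul_sub] at hl
  rw [← Finset.mul_sum, abs_mul, abs_of_pos (by positivity)] at hl
  have hpi := Real.pi_gt_three
  have := abs_nonneg (∑ n ∈ Finset.range N,
    (periodicBernoulliTwo (x n + η) - periodicBernoulliTwo (x n)))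
  nlinarith [mul_nonneg this (by nlinarith : 0 ≤ Real.pi ^ 2 - 7)]

lemma two_mul_abs_sum_saw_le (x : ℕ → ℝ) (N : ℕ) {δ B : ℝ} (h0 : 0 ≤ δ) (h1 : δ ≤ 1)
    (hB : ∀ M : ℕ, ∑ h ∈ Finset.range M, 1 / (h : ℝ) ^ 2 * (min 1 (h * δ) *
      ‖∑ n ∈ Finset.range N, unitExp (h * x n)‖) ≤ B) :
    2 * δ * |∑ n ∈ Finset.range N, saw (x n)| ≤ N * δ ^ 2 + B := by
  have p := abs_sum_periodicBernoulliTwo_sub_le x N δ (B := B) (by rwa [abs_of_nonneg h0])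
  have m := abs_sum_periodicBernoulliTwo_sub_le x N (-δ) (B := B)
    (by rwa [abs_neg, abs_of_nonneg h0])
  have p' := Finset.sum_le_sum fun n (_ : n ∈ Finset.range N) =>
    periodicBernoulliTwo_add_sub_le h0 h1 (x n)
  have m' := Finset.sum_le_sum fun n (_ : n ∈ Finset.range N) =>
    le_periodicBernoulliTwo_sub_sub h0 h1 (x n)
  simp only [Finset.sum_add_distrib, Finset.sum_sub_distrib, ← Finset.mul_sum, Finset.sum_const,
    Finset.card_range, nsmul_eq_mul] at p' m' p m
  rw [abs_le] at p m
  have : |2 * δ * ∑ n ∈ Finset.range N, saw (x n)| ≤ N * δ ^ 2 + B :=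
    abs_le.2 ⟨by linarith, by linarith⟩
  rwa [abs_mul, abs_of_nonneg (by positivity)] at this

lemma mul_rpow_sub_one_le_rpow_sub {κ x : ℝ} (h0 : 0 ≤ κ) (h1 : κ ≤ 1) (hx : 1 ≤ x) :
    κ * x ^ (κ - 1) ≤ x ^ κ - (x - 1) ^ κ := by
  have hx0 : 0 < x := by linarith
  have hi : 1 / x ≤ 1 := by rw [div_le_one hx0]; exact hx
  have hb := rpow_one_add_le_one_add_mul_self (s := -(1 / x)) (by linarith) h0 h1
  have e : x - 1 = x * (1 + -(1 / x)) := by field_simp; ring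
  rw [e, Real.mul_rpow hx0.le (by linarith), Real.rpow_sub_one hx0.ne']
  calc κ * (x ^ κ / x) = x ^ κ - x ^ κ * (1 + κ * -(1 / x)) := by field_simp; ring
    _ ≤ _ := by gcongr

lemma mul_rpow_sub_two_le_rpow_sub {κ x : ℝ} (h0 : 0 ≤ κ) (h1 : κ < 1) (hx : 1 < x) :
    (1 - κ) * x ^ (κ - 2) ≤ (x - 1) ^ (κ - 1) - x ^ (κ - 1) := by
  have hx0 : 0 < x := by linarith
  have hi : 1 / x < 1 := by rw [div_lt_one hx0]; exact hx
  have hi0 : 0 < 1 / x := by positivity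
  have hb := rpow_one_add_le_one_add_mul_self (s := -(1 / x)) (p := 1 - κ) (by linarith)
    (by linarith) (by linarith)
  have hp : 0 < (1 + -(1 / x)) ^ (1 - κ) := Real.rpow_pos_of_pos (by linarith) _
  have e : x - 1 = x * (1 + -(1 / x)) := by field_simp; ring
  have e2 : x ^ (κ - 2) = x ^ (κ - 1) * (1 / x) := by
    rw [show κ - 2 = κ - 1 - 1 by ring, Real.rpow_sub_one hx0.ne', mul_one_div]
  have e3 : (1 + -(1 / x)) ^ (κ - 1) = ((1 + -(1 / x)) ^ (1 - κ))⁻¹ := by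
    rw [← Real.rpow_neg (by linarith)]; congr 1; ring
  have hk : 1 + (1 - κ) * (1 / x) ≤ ((1 + -(1 / x)) ^ (1 - κ))⁻¹ := by
    rw [le_inv_comm₀ (by nlinarith) hp]
    refine hb.trans ?_
    rw [← one_div, le_div_iff₀ (by nlinarith)]
    nlinarith [sq_nonneg ((1 - κ) * (1 / x))]
  rw [e, Real.mul_rpow hx0.le (by linarith), e2, e3]
  calc (1 - κ) * (x ^ (κ - 1) * (1 / x)) =
      x ^ (κ - 1) * (1 + (1 - κ) * (1 / x)) - x ^ (κ - 1) := by ring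
    _ ≤ _ := by gcongr

lemma sum_rpow_mul_min_le {κ δ : ℝ} (h0 : 0 < κ) (h1 : κ < 1) (hδ : 0 < δ) (hδ1 : δ ≤ 1) (M : ℕ) :
    ∑ h ∈ Finset.range (M + 1), (h : ℝ) ^ (κ - 2) * min 1 (h * δ) ≤
      δ ^ (1 - κ) * (1 / κ + 2 / (1 - κ)) := by
  have h1' : 0 < 1 - κ := by linarith
  have small : ∀ M : ℕ, M * δ ≤ 1 → δ / κ * (M : ℝ) ^ κ ≤ δ ^ (1 - κ) * (1 / κ) := by
    intro M hM
    have : (M : ℝ) ^ κ ≤ δ ^ (-κ) := by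
      rw [Real.rpow_neg hδ.le, ← Real.inv_rpow hδ.le]
      refine Real.rpow_le_rpow (by positivity) ?_ h0.le
      rwa [← one_div, le_div_iff₀ hδ]
    calc δ / κ * (M : ℝ) ^ κ ≤ δ / κ * δ ^ (-κ) := by gcongr
      _ = _ := by rw [sub_eq_add_neg, Real.rpow_add hδ, Real.rpow_one]; ring
  have key : ∀ M : ℕ, (M * δ ≤ 1 → ∑ h ∈ Finset.range (M + 1), (h : ℝ) ^ (κ - 2) *
        min 1 (h * δ) ≤ δ / κ * (M : ℝ) ^ κ) ∧
      (1 < M * δ → ∑ h ∈ Finset.range (M + 1), (h : ℝ) ^ (κ - 2) * min 1 (h * δ) ≤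
        δ ^ (1 - κ) * (1 / κ + 2 / (1 - κ)) - (M : ℝ) ^ (κ - 1) / (1 - κ)) := by
    intro M
    induction M with
    | zero =>
      refine ⟨fun _ => ?_, fun h => ?_⟩
      · simp [Real.zero_rpow h0.ne']
      · norm_num at h
    | succ M ih =>
      have hm : (1 : ℝ) ≤ ((M + 1 : ℕ) : ℝ) := by push_cast; linarith [M.cast_nonneg (α := ℝ)]
      have hM : (M : ℝ) = ((M + 1 : ℕ) : ℝ) - 1 := by push_cast; ring
      rw [Finset.sum_range_succ]
      generalize ((M + 1 : ℕ) : ℝ) = m at hm hM ⊢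
      have hm0 : 0 < m := by linarith
      have hterm : m ^ (κ - 2) * min 1 (m * δ) ≤ m ^ (κ - 2) :=
        mul_le_of_le_one_right (by positivity) (min_le_left _ _)
      refine ⟨fun h => ?_, fun h => ?_⟩
      · have ih1 := ih.1 (by rw [hM]; nlinarith)
        have hk := mul_rpow_sub_one_le_rpow_sub h0.le h1.le hm
        rw [← hM] at hk
        have ht : m ^ (κ - 2) * min 1 (m * δ) ≤ δ / κ * (m ^ κ - (M : ℝ) ^ κ) := by
          calc m ^ (κ - 2) * min 1 (m * δ) ≤ m ^ (κ - 2) * (m * δ) := by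
                gcongr; exact min_le_right _ _
            _ = δ / κ * (κ * m ^ (κ - 1)) := by
                rw [show κ - 1 = κ - 2 + 1 by ring, Real.rpow_add_one hm0.ne']
                field_simp
            _ ≤ _ := by gcongr
        linarith
      · rcases le_or_gt (M * δ) 1 with h' | h'
        · have ih1 := (ih.1 h').trans (small M h')
          have hmδ : m ^ (κ - 1) ≤ δ ^ (1 - κ) := by
            rw [show κ - 1 = -(1 - κ) by ring, Real.rpow_neg hm0.le, ← Real.inv_rpow hm0.le]
            refine Real.rpow_le_rpow (by positivity) ?_ h1'.le
            rw [← one_div, div_le_iff₀ hm0]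
            linarith
          have h3 : m ^ (κ - 2) ≤ m ^ (κ - 1) := Real.rpow_le_rpow_of_exponent_le hm (by linarith)
          have h4 : m ^ (κ - 1) ≤ m ^ (κ - 1) / (1 - κ) :=
            le_div_self (by positivity) h1' (by linarith)
          have h5 : m ^ (κ - 1) / (1 - κ) ≤ δ ^ (1 - κ) / (1 - κ) := by gcongr
          have h6 : δ ^ (1 - κ) * (1 / κ + 2 / (1 - κ)) =
            δ ^ (1 - κ) * (1 / κ) + 2 * (δ ^ (1 - κ) / (1 - κ)) := by ring
          linarith
        · have ih2 := ih.2 h'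
          have hm1 : 1 < m := by nlinarith
          have hk := mul_rpow_sub_two_le_rpow_sub h0.le h1 hm1
          rw [← hM, mul_comm, ← le_div_iff₀ h1', sub_div] at hk
          linarith
  rcases le_or_gt (M * δ) 1 with h | h
  · refine ((key M).1 h).trans ((small M h).trans ?_)
    gcongr
    have : 0 < 2 / (1 - κ) := by positivity
    linarith
  · refine ((key M).2 h).trans ?_
    have : 0 ≤ (M : ℝ) ^ (κ - 1) / (1 - κ) := by positivity
    linarith

/-- Bounds for exponential sums at all frequencies give a bound for the sawtooth sum. -/
lemma abs_sum_saw_le {κ δ U V : ℝ} (h0 : 0 < κ) (h1 : κ < 1) (hδ : 0 < δ) (hδ1 : δ ≤ 1)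
    (hU : 0 ≤ U) (hV : 0 ≤ V) (x : ℕ → ℝ) (N : ℕ)
    (hx : ∀ h : ℕ, 1 ≤ h →
      ‖∑ n ∈ Finset.range N, unitExp (h * x n)‖ ≤ U * (h : ℝ) ^ κ + V / h) :
    |∑ n ∈ Finset.range N, saw (x n)| ≤ N * δ + U * δ ^ (-κ) * (1 / κ + 2 / (1 - κ)) + V := by
  have h1' : 0 < 1 - κ := by linarith
  have hδe : δ ^ (1 - κ) = δ * δ ^ (-κ) := by
    rw [sub_eq_add_neg, Real.rpow_add hδ, Real.rpow_one]
  have hz : ∀ M : ℕ, ∑ h ∈ Finset.range M, 1 / (h : ℝ) ^ 2 ≤ 2 := fun M =>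
    (sum_le_hasSum _ (fun _ _ => by positivity) hasSum_zeta_two).trans (by
      nlinarith [Real.pi_lt_d2, Real.pi_pos])
  have hB : ∀ M : ℕ, ∑ h ∈ Finset.range M, 1 / (h : ℝ) ^ 2 * (min 1 (h * δ) *
      ‖∑ n ∈ Finset.range N, unitExp (h * x n)‖) ≤
      U * (δ ^ (1 - κ) * (1 / κ + 2 / (1 - κ))) + V * δ * 2 := by
    intro M
    have hterm : ∀ h : ℕ, 1 / (h : ℝ) ^ 2 * (min 1 (h * δ) *
        ‖∑ n ∈ Finset.range N, unitExp (h * x n)‖) ≤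
        U * ((h : ℝ) ^ (κ - 2) * min 1 (h * δ)) + V * δ * (1 / (h : ℝ) ^ 2) := by
      intro h
      rcases Nat.eq_zero_or_pos h with rfl | hh
      · simp
      have hh0 : (0 : ℝ) < h := by exact_mod_cast hh
      have hmin : 0 ≤ min 1 (h * δ) := le_min (by norm_num) (by positivity)
      have hmin' : min 1 (h * δ) * (V / h) ≤ V * δ := by
        calc min 1 (h * δ) * (V / h) ≤ h * δ * (V / h) := by gcongr; exact min_le_right _ _
          _ = V * δ := by field_simp
      calc 1 / (h : ℝ) ^ 2 * (min 1 (h * δ) * ‖∑ n ∈ Finset.range N, unitExp (h * x n)‖)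
          ≤ 1 / (h : ℝ) ^ 2 * (min 1 (h * δ) * (U * (h : ℝ) ^ κ + V / h)) := by
            gcongr; exact hx h hh
        _ = U * ((h : ℝ) ^ κ / (h : ℝ) ^ 2 * min 1 (h * δ)) +
            min 1 (h * δ) * (V / h) * (1 / (h : ℝ) ^ 2) := by ring
        _ ≤ U * ((h : ℝ) ^ κ / (h : ℝ) ^ 2 * min 1 (h * δ)) + V * δ * (1 / (h : ℝ) ^ 2) := by
            gcongr
        _ = _ := by rw [Real.rpow_sub hh0, Real.rpow_two]
    calc _ ≤ ∑ h ∈ Finset.range (M + 1), 1 / (h : ℝ) ^ 2 * (min 1 (h * δ) *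
          ‖∑ n ∈ Finset.range N, unitExp (h * x n)‖) :=
          Finset.sum_le_sum_of_subset_of_nonneg (Finset.range_subset_range.2 (Nat.le_succ M))
            fun h _ _ => by
              have : 0 ≤ min 1 (h * δ) := le_min (by norm_num) (by positivity)
              positivity
      _ ≤ ∑ h ∈ Finset.range (M + 1), (U * ((h : ℝ) ^ (κ - 2) * min 1 (h * δ)) +
          V * δ * (1 / (h : ℝ) ^ 2)) := Finset.sum_le_sum fun h _ => hterm h
      _ ≤ _ := by
          rw [Finset.sum_add_distrib, ← Finset.mul_sum, ← Finset.mul_sum]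
          gcongr
          · exact sum_rpow_mul_min_le h0 h1 hδ hδ1 M
          · exact hz _
  have h2 := two_mul_abs_sum_saw_le x N hδ.le hδ1 hB
  rw [hδe] at h2
  have h3 : δ * (2 * |∑ n ∈ Finset.range N, saw (x n)|) ≤
      δ * (N * δ + U * δ ^ (-κ) * (1 / κ + 2 / (1 - κ)) + 2 * V) := by linarith
  have h4 := le_of_mul_le_mul_left h3 hδ
  have h5 : 0 ≤ N * δ := by positivity
  have h6 : 0 ≤ U * δ ^ (-κ) * (1 / κ + 2 / (1 - κ)) := by positivity
  linarith

/-- with `q = ⌊r⌋ + 1`, `Q = 2^q`, `κ = 1/(4Q − 2)`,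
`λ = 1 − (q+1)/(4Q − 2)`, for `K ≥ 3`, `e ≥ 1` and any real `θ`,
`|Σ_{K ≤ k < 2K} ψ(k^r/e + θ)| ≪_r e·K^{1−r} + e^{−κ/(1+κ)}·K^{(rκ+λ)/(1+κ)}`. -/
theorem saw_sum_exponent_pair (r : ℝ) (hr : 1 < r) (hri : ∀ m : ℤ, r ≠ m)
    (q Q : ℕ) (hq : q = ⌊r⌋₊ + 1) (hQ : Q = 2 ^ q)
    (κ lam : ℝ) (hκ : κ = 1 / (4 * (Q : ℝ) - 2))
    (hlamdef : lam = 1 - ((q : ℝ) + 1) / (4 * (Q : ℝ) - 2)) :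
    ∃ C : ℝ, ∀ K : ℝ, 3 ≤ K → ∀ e : ℕ, 1 ≤ e → ∀ θ : ℝ,
      |∑ k ∈ Finset.Ico ⌈K⌉₊ ⌈2 * K⌉₊, saw ((k : ℝ) ^ r / (e : ℝ) + θ)| ≤
        C * ((e : ℝ) * K ^ (1 - r)
          + (e : ℝ) ^ (-(κ / (1 + κ))) * K ^ ((r * κ + lam) / (1 + κ))) := by
  obtain ⟨C, hC, hS⟩ := norm_powSum_le_exponent_pair hr hri (j := q + 2) (by omega)
  have hQκ : 1 / ((2 : ℝ) ^ (q + 2) - 2) = κ := by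
    rw [hκ, hQ]
    push_cast
    ring
  have hQ2 : (2 : ℝ) ≤ Q := by
    rw [hQ, hq, pow_succ]
    push_cast
    linarith [one_le_pow₀ (one_le_two (α := ℝ)) (n := ⌊r⌋₊)]
  have hκ0 : 0 < κ := by rw [hκ]; exact div_pos one_pos (by linarith)
  have hκ1 : κ < 1 := by rw [hκ, div_lt_one (by linarith)]; linarith
  have hκ1' : 0 < 1 - κ := by linarith
  have hlam : lam = 1 - (q + 1) * κ := by rw [hlamdef, hκ]; ring
  have hrq : r < q := by rw [hq]; push_cast; exact Nat.lt_floor_add_one r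
  rw [hQκ] at hS
  set A : ℝ := 1 / κ + 2 / (1 - κ) with hA
  have hA0 : 0 < A := by positivity
  refine ⟨2 + C * A + C, fun K hK e he θ => ?_⟩
  have hK0 : 0 < K := by linarith
  have he1 : (1 : ℝ) ≤ e := by exact_mod_cast he
  have he0 : (0 : ℝ) < e := by linarith
  set ω : ℝ := K ^ (r - (q + 2 : ℕ)) / e with hω
  have hω0 : 0 < ω := by positivity
  have hω1 : ω ≤ 1 := by
    rw [hω, div_le_one he0]
    refine le_trans (Real.rpow_le_one_of_one_le_of_nonpos (by linarith) ?_) he1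
    push_cast
    linarith
  set δ : ℝ := ω ^ (κ / (1 + κ)) with hδ
  have hδ0 : 0 < δ := by positivity
  have hδ1 : δ ≤ 1 := Real.rpow_le_one hω0.le hω1 (by positivity)
  have hωδ : ω ^ κ * δ ^ (-κ) = δ := by
    rw [hδ, ← Real.rpow_mul hω0.le, ← Real.rpow_add hω0]
    congr 1
    field_simp
    ring
  have hKδ : K * δ = (e : ℝ) ^ (-(κ / (1 + κ))) * K ^ ((r * κ + lam) / (1 + κ)) := by
    rw [hδ, hω, Real.div_rpow (by positivity) he0.le, ← Real.rpow_mul hK0.le,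
      Real.rpow_neg he0.le, mul_div_assoc', div_eq_inv_mul]
    nth_rewrite 1 [← Real.rpow_one K]
    rw [← Real.rpow_add hK0, hlam]
    congr 2
    push_cast
    field_simp
    ring
  have hx : ∀ h : ℕ, 1 ≤ h → ‖∑ n ∈ Finset.range (⌈2 * K⌉₊ - ⌈K⌉₊),
      unitExp (h * (((⌈K⌉₊ + n : ℕ) : ℝ) ^ r / e + θ))‖ ≤
      C * K * ω ^ κ * (h : ℝ) ^ κ + C * (e * K ^ (1 - r)) / h := by
    intro h hh
    have hh0 : (0 : ℝ) < h := by exact_mod_cast hh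
    have hSh := hS K (h / e) hK (by positivity)
    have e1 : ∀ n : ℕ, unitExp (h * (((⌈K⌉₊ + n : ℕ) : ℝ) ^ r / e + θ)) =
        unitExp (h / e * ((⌈K⌉₊ + n : ℕ) : ℝ) ^ r) * unitExp (h * θ) := by
      intro n
      rw [← unitExp_add]
      congr 1
      ring
    simp only [e1]
    rw [← Finset.sum_mul, norm_mul, norm_unitExp, mul_one]
    refine hSh.trans_eq ?_
    have e2 : (h : ℝ) / e * K ^ (r - (q + 2 : ℕ)) = h * ω := by rw [hω]; ring
    rw [e2, Real.mul_rpow hh0.le hω0.le, show (1 : ℝ) - r = -(r - 1) by ring, Real.rpow_neg hK0.le]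
    field_simp
  have hmain := abs_sum_saw_le hκ0 hκ1 hδ0 hδ1 (by positivity) (by positivity) _ _ hx
  rw [Finset.sum_Ico_eq_sum_range]
  refine hmain.trans ?_
  have hN : ((⌈2 * K⌉₊ - ⌈K⌉₊ : ℕ) : ℝ) * δ ≤ 2 * (K * δ) := by
    rw [← mul_assoc]
    exact mul_le_mul_of_nonneg_right (card_dyadic_le hK) hδ0.le
  have hU : C * K * ω ^ κ * δ ^ (-κ) * A = C * A * (K * δ) := by
    calc _ = C * A * (K * (ω ^ κ * δ ^ (-κ))) := by ring
      _ = _ := by rw [hωδ]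
  rw [← hA, hU, ← hKδ]
  have hp1 : 0 ≤ C * (K * δ) := by positivity
  have hp2 : 0 ≤ (2 + C * A) * (e * K ^ (1 - r)) := by positivity
  linarith
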